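/- arXiv:1705.04630 — 5 statements merged into one kernel-verified Lean document; each statement's English description precedes it below -/
import Mathlib

section
/- Let G be a gambler and b > 0. Then for every n ∈ ℕ, every y ∈ O^{n−1}, and every μ̄ ∈ P(O^ω)^n, one has SVmin (Bd_b G)_n(y,μ̄) ≥ −b. -/
open MeasureTheory Filter Set Topology
open scoped NNReal ENNReal

noncomputable section

/-- The completion of the ambient σ-algebra with respect to a measure `μ`:
the σ-algebra of `μ`-null-measurable sets. -/
def completionMS {Y : Type*} [MeasurableSpace Y] (μ : Measure Y) : MeasurableSpace Y where
  MeasurableSet' s := NullMeasurableSet s μ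
  measurableSet_empty := MeasurableSet.empty.nullMeasurableSet
  measurableSet_compl := fun _ h => h.compl
  measurableSet_iUnion := fun _ h => NullMeasurableSet.iUnion h

/-- The σ-algebra of universally measurable sets: the intersection of the completions
of the ambient (Borel) σ-algebra with respect to all probability measures. -/
def univMS (Y : Type*) [MeasurableSpace Y] : MeasurableSpace Y :=
  ⨅ (μ : Measure Y) (_ : IsProbabilityMeasure μ), completionMS μ

/-- The support of a probability measure: the set of points all of whose open
neighbourhoods have positive measure. -/
def msupp {X : Type*} [TopologicalSpace X] [MeasurableSpace X] (μ : ProbabilityMeasure X) :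
    Set X :=
  {x | ∀ U : Set X, IsOpen U → x ∈ U → 0 < μ.toMeasure U}

/-- `ρ` is a metrization of the topological space `X`: it is a metric and the
neighbourhood filters are generated by its open balls. -/
structure IsMetrization {X : Type*} [TopologicalSpace X] (ρ : X → X → ℝ) : Prop where
  refl : ∀ x, ρ x x = 0
  pos : ∀ x y, x ≠ y → 0 < ρ x y
  symm : ∀ x y, ρ x y = ρ y x
  triangle : ∀ x y z, ρ x z ≤ ρ x y + ρ y z
  nhds_basis : ∀ x : X, (nhds x).HasBasis (fun ε : ℝ => 0 < ε) (fun ε => {y | ρ x y < ε})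

/-- `f` is Lipschitz with respect to the metric `ρ`. -/
def LipWrt {X : Type*} (ρ : X → X → ℝ) (f : X → ℝ) : Prop :=
  ∃ K : ℝ, ∀ x y, |f x - f y| ≤ K * ρ x y

/-- The norm `‖f‖_ρ := max_x |f x| + sup_{x ≠ y} |f x - f y| / ρ x y` on Lipschitz functions. -/
def lipNorm {X : Type*} (ρ : X → X → ℝ) (f : X → ℝ) : ℝ :=
  (⨆ x, |f x|) + sSup {c | ∃ x y, x ≠ y ∧ c = |f x - f y| / ρ x y}

/-- The Kantorovich-Rubinstein distance
`D^ρ(μ, ν) := sup {E_μ[f] - E_ν[f] | f Lipschitz, ‖f‖_ρ ≤ 1}`. -/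
def KRdist {X : Type*} [MeasurableSpace X] (ρ : X → X → ℝ) (μ ν : ProbabilityMeasure X) : ℝ :=
  sSup {c | ∃ f : X → ℝ, LipWrt ρ f ∧ lipNorm ρ f ≤ 1 ∧
    c = (∫ x, f x ∂(μ : Measure X)) - ∫ x, f x ∂(ν : Measure X)}

/-- The Kantorovich-Rubinstein distance from a measure to a set of measures. -/
def KRdistSet {X : Type*} [MeasurableSpace X] (ρ : X → X → ℝ) (μ : ProbabilityMeasure X)
    (A : Set (ProbabilityMeasure X)) : ℝ :=
  sInf {c | ∃ ν ∈ A, c = KRdist ρ μ ν}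

/-- Convexity for a set of probability measures. -/
def ConvexPM {X : Type*} [MeasurableSpace X] (A : Set (ProbabilityMeasure X)) : Prop :=
  ∀ μ ∈ A, ∀ ν ∈ A, ∀ p : ℝ≥0, p ≤ 1 → ∀ ξ : ProbabilityMeasure X,
    (ξ : Measure X) = p • (μ : Measure X) + (1 - p) • (ν : Measure X) → ξ ∈ A

/-- `κ` is a regular conditional probability for `μ` given `π`: it is a measurable family
of probability measures which disintegrates `μ` over `π_* μ` and is concentrated on fibers. -/
def IsRCP {X Y : Type*} [MeasurableSpace X] [MeasurableSpace Y]
    (μ : Measure X) (π : X → Y) (κ : Y → ProbabilityMeasure X) : Prop :=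
  Measurable (fun y => (κ y : Measure X)) ∧
  (∀ s : Set X, MeasurableSet s → ∀ t : Set Y, MeasurableSet t →
    μ (s ∩ π ⁻¹' t) = ∫⁻ y in t, (κ y : Measure X) s ∂(μ.map π)) ∧
  (∀ᵐ y ∂(μ.map π), (κ y : Measure X) (π ⁻¹' {y}) = 1)

/-- `N` is a regular upper bound for `M | π` (Definition 2.2 of the paper). -/
structure IsRUB {X Y : Type*} [TopologicalSpace X] [TopologicalSpace Y]
    [MeasurableSpace X] [MeasurableSpace Y] [OpensMeasurableSpace X]
    (π : X → Y) (M : Set (ProbabilityMeasure X)) (N : Y → Set (ProbabilityMeasure X)) : Prop where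
  closed : IsClosed {p : Y × ProbabilityMeasure X | p.2 ∈ N p.1}
  convex : ∀ y, ConvexPM (N y)
  cond : ∀ μ ∈ M, ∀ κ : Y → ProbabilityMeasure X, IsRCP (μ : Measure X) π κ →
    ∀ᵐ y ∂((μ : Measure X).map π), κ y ∈ N y

/-- `β` is an `(M, r₀)`-savvy bet (with respect to the metric `ρ`). -/
def IsSavvy {X : Type*} [TopologicalSpace X] [MeasurableSpace X] [OpensMeasurableSpace X]
    (ρ : X → X → ℝ) (M : Set (ProbabilityMeasure X)) (r₀ : ℝ)
    (β : ProbabilityMeasure X × X → ℝ) : Prop :=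
  Continuous β ∧
  ∀ μ : ProbabilityMeasure X,
    (∀ x, |β (μ, x)| ≤ max (KRdistSet ρ μ M - r₀) 0) ∧
    ∀ ν ∈ M, (1/2) * (KRdistSet ρ μ M - r₀) * KRdistSet ρ μ M ≤
      (∫ x, β (μ, x) ∂(ν : Measure X)) - ∫ x, β (μ, x) ∂(μ : Measure X)

/-- Borel σ-algebra on the space of probability measures (with its weak topology). -/
instance {X : Type*} [TopologicalSpace X] [MeasurableSpace X] [OpensMeasurableSpace X] :
    MeasurableSpace (ProbabilityMeasure X) := borel _

/-- Borel σ-algebra on a space of continuous functions. -/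
instance {Y : Type*} [TopologicalSpace Y] : MeasurableSpace C(Y, ℝ) := borel _

end
noncomputable section

variable (O : ℕ → Type*) [∀ n, TopologicalSpace (O n)] [∀ n, CompactSpace (O n)]
  [∀ n, PolishSpace (O n)] [∀ n, MeasurableSpace (O n)] [∀ n, BorelSpace (O n)]

/-- The space `O^n` of observation histories of length `n`. -/
abbrev Hn (n : ℕ) : Type _ := ∀ i : Fin n, O i

/-- The space `O^ω` of infinite observation sequences. -/
abbrev Hw : Type _ := ∀ n : ℕ, O n

/-- The projection `O^ω → O^n`, `x ↦ x_{:n}`. -/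
def proj (n : ℕ) : Hw O → Hn O n := fun x i => x i

/-- The cylinder `yO^ω` over `y ∈ O^n`. -/
def cyl (n : ℕ) (y : Hn O n) : Set (Hw O) := {x | proj O n x = y}

/-- Truncation `O^n → O^m` for `m ≤ n`. -/
def trunc {m n : ℕ} (h : m ≤ n) (y : Hn O n) : Hn O m := fun i => y (i.castLE h)

/-- The payoff `(Vβ)(μ, x) := β(μ, x) - E_{x' ∼ μ}[β(μ, x')]` of a bet `β`. -/
def Vbet {X : Type*} [MeasurableSpace X]
    (β : ProbabilityMeasure X × X → ℝ) (μ : ProbabilityMeasure X) (x : X) : ℝ :=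
  β (μ, x) - ∫ x', β (μ, x') ∂(μ : Measure X)

/-- The sup norm of a bet. -/
def gmNorm {X : Type*} [MeasurableSpace X] (β : ProbabilityMeasure X × X → ℝ) : ℝ :=
  ⨆ p, |β p|

/-- A forecaster: a family of measurable maps `F_n : O^n → P(O^ω)` (with `O^n` carrying the
σ-algebra of universally measurable sets), whose forecasts are supported on the observed
cylinder. -/
structure Forecaster where
  F : ∀ n, Hn O n → ProbabilityMeasure (Hw O)
  measurable : ∀ n, @Measurable _ _ (univMS (Hn O n)) inferInstance (F n)
  supp : ∀ n y, msupp (F n y) ⊆ cyl O n y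

/-- The (not necessarily continuous or measurable) data of a gambler: for each `n`, a map
assigning to an observation history and a forecast history a bet. -/
abbrev PreGambler : Type _ := ∀ n : ℕ, Hn O n × (Fin n → ProbabilityMeasure (Hw O)) →
  ProbabilityMeasure (Hw O) × Hw O → ℝ

/-- A gambler: a family of measurable maps `G_n : O^n × P(O^ω)^n → Gm(O^ω)`, where `O^n`
carries the universally measurable σ-algebra, `P(O^ω)^n` the Borel σ-algebra, and the space
`Gm(O^ω) = C(P(O^ω) × O^ω)` of bets the Borel σ-algebra. -/
structure Gambler where
  G : ∀ n : ℕ, Hn O n × (Fin n → ProbabilityMeasure (Hw O)) →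
    C(ProbabilityMeasure (Hw O) × Hw O, ℝ)
  measurable : ∀ n, @Measurable _ _ (MeasurableSpace.prod (univMS (Hn O n)) inferInstance)
    inferInstance (G n)

/-- The underlying bet-valued data of a gambler. -/
def Gambler.pre (G : Gambler O) : PreGambler O := fun n yμ p => G.G n yμ p

/-- The forecast history of a forecaster along an observation history. -/
def fhist (F : ∀ n, Hn O n → ProbabilityMeasure (Hw O)) (n : ℕ) (y : Hn O n) :
    Fin n → ProbabilityMeasure (Hw O) := fun m => F m (trunc O m.isLt.le y)

/-- The total payoff `SV G_n(y, μ̄)(x)` of the first `n` gambles of a gambler `G`,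
given forecasts `μ̄` (here `y ∈ O^{n-1}`). -/
def SVg (G : PreGambler O) (n : ℕ) (y : Hn O (n-1))
    (μs : Fin n → ProbabilityMeasure (Hw O)) (x : Hw O) : ℝ :=
  ∑ m : Fin n, Vbet (G m (trunc O (Nat.le_pred_of_lt m.isLt) y,
      fun i : Fin m => μs (i.castLE m.isLt.le)))
    (μs m) x

/-- The minimal total payoff `SVmin G_n(y, μ̄)` over the cylinder `yO^ω`. -/
def SVgMin (G : PreGambler O) (n : ℕ) (y : Hn O (n-1))
    (μs : Fin n → ProbabilityMeasure (Hw O)) : ℝ :=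
  sInf (SVg O G n y μs '' cyl O (n-1) y)

/-- The maximal total payoff `SVmax G_n(y, μ̄)` over the cylinder `yO^ω`. -/
def SVgMax (G : PreGambler O) (n : ℕ) (y : Hn O (n-1))
    (μs : Fin n → ProbabilityMeasure (Hw O)) : ℝ :=
  sSup (SVg O G n y μs '' cyl O (n-1) y)

/-- The total payoff `SV G^F_n(x)` of the first `n` gambles of a gambler `G` playing
against a forecaster `F`, along the observation sequence `x`. -/
def SVf (G : PreGambler O) (F : ∀ n, Hn O n → ProbabilityMeasure (Hw O)) (n : ℕ)
    (x : Hw O) : ℝ :=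
  ∑ m : Fin n, Vbet (G m (proj O m x, fhist O F m (proj O m x))) (F m (proj O m x)) x

/-- The minimal total payoff `SVmin G^F_n(y)` over the cylinder `yO^ω`, `y ∈ O^{n-1}`. -/
def SVfMin (G : PreGambler O) (F : ∀ n, Hn O n → ProbabilityMeasure (Hw O)) (n : ℕ)
    (y : Hn O (n-1)) : ℝ :=
  sInf (SVf O G F n '' cyl O (n-1) y)

/-- The maximal total payoff `SVmax G^F_n(y)` over the cylinder `yO^ω`, `y ∈ O^{n-1}`. -/
def SVfMax (G : PreGambler O) (F : ∀ n, Hn O n → ProbabilityMeasure (Hw O)) (n : ℕ)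
    (y : Hn O (n-1)) : ℝ :=
  sSup (SVf O G F n '' cyl O (n-1) y)

/-- A forecaster (given by its family of forecasts) dominates a gambler when, along every
observation sequence, if the gambler's minimal total payoff is bounded below then its
maximal total payoff is bounded above. -/
def Dominates (F : ∀ n, Hn O n → ProbabilityMeasure (Hw O)) (G : PreGambler O) : Prop :=
  ∀ x : Hw O,
    BddBelow (Set.range fun n => SVfMin O G F n (proj O (n-1) x)) →
    BddAbove (Set.range fun n => SVfMax O G F n (proj O (n-1) x))

/-- A gambling strategy: a uniformly bounded family of measurable maps `S_n : O^n → Gm(O^ω)`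
(not depending on the forecast history). -/
structure Strategy where
  S : ∀ n : ℕ, Hn O n → C(ProbabilityMeasure (Hw O) × Hw O, ℝ)
  measurable : ∀ n, @Measurable _ _ (univMS (Hn O n)) inferInstance (S n)
  bounded : ∃ C : ℝ, ∀ n y p, |S n y p| ≤ C

open scoped Classical in
/-- The gambler `PG S` associated to a gambling strategy `S`: it plays `S` in round `n`
exactly when the uncertainty about the total payoff of previous bets is at most `1`. -/
def PGfun (S : Strategy O) : (n : ℕ) → Hn O n × (Fin n → ProbabilityMeasure (Hw O)) →
    C(ProbabilityMeasure (Hw O) × Hw O, ℝ)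
  | n, yμ =>
    let sv : Hw O → ℝ := fun x =>
      ∑ m : Fin n, Vbet (fun p => PGfun S m
          (trunc O m.isLt.le yμ.1, fun i : Fin m => yμ.2 (i.castLE m.isLt.le)) p)
        (yμ.2 m) x
    if sSup (sv '' cyl O (n-1) (trunc O (Nat.sub_le n 1) yμ.1)) -
        sInf (sv '' cyl O (n-1) (trunc O (Nat.sub_le n 1) yμ.1)) ≤ 1
    then S.S n yμ.1 else 0
termination_by n => n
decreasing_by exact m.isLt

/-- The gambler `PG S`, as gambling data. -/
def PGpre (S : Strategy O) : PreGambler O := fun n yμ p => PGfun O S n yμ p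

/-- The normalization factor `Nr_b G_n(y, μ̄; ν)` used to enforce a finite budget `b`. -/
def NrFun (G : PreGambler O) (b : ℝ) (n : ℕ) (y : Hn O n)
    (μs : Fin n → ProbabilityMeasure (Hw O)) (ν : ProbabilityMeasure (Hw O)) : ℝ :=
  (max 1 (sSup ((fun x => (-(Vbet (G n (y, μs)) ν x)) /
      (SVg O G n (trunc O (Nat.sub_le n 1) y) μs x + b)) '' cyl O n y)))⁻¹

open scoped Classical in
/-- The gambler `Bd_b G`: the modification of `G` which never loses more than the budget
`b`. -/
def BdG (G : PreGambler O) (b : ℝ) : PreGambler O := fun n yμ =>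
  if ∀ m : Fin n, -b < SVgMin O G (m.1+1) (trunc O m.isLt.le yμ.1)
      (fun i : Fin (m.1+1) => yμ.2 (i.castLE m.isLt)) then
    fun p => NrFun O G b n yμ.1 yμ.2 p.1 * G n yμ p
  else fun _ => 0

/-- A gambling strategy `S` is `μ*`-prudent when, for some `α > 0`, for every round, almost
every observation history and every forecast, the expected payoff of the bet under the true
environment `μ*` exceeds the payoff under the forecast by at least `α` times the spread of
the bet. -/
def IsPrudent (S : Strategy O) (μstar : ProbabilityMeasure (Hw O)) : Prop :=
  ∃ α : ℝ, 0 < α ∧ ∀ n : ℕ, ∀ κ : Hn O n → ProbabilityMeasure (Hw O),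
    IsRCP (μstar : Measure (Hw O)) (proj O n) κ →
      ∀ᵐ y ∂((μstar : Measure (Hw O)).map (proj O n)), ∀ μ : ProbabilityMeasure (Hw O),
        α * (sSup ((fun x => S.S n y (μ, x)) '' cyl O n y) -
             sInf ((fun x => S.S n y (μ, x)) '' cyl O n y)) ≤
          (∫ x, S.S n y (μ, x) ∂(κ y : Measure (Hw O))) -
            ∫ x, S.S n y (μ, x) ∂(μ : Measure (Hw O))

section BudgetedGambler

variable {O}

lemma continuous_SVg (G : Gambler O) (n : ℕ) (y : Hn O (n-1))
    (μs : Fin n → ProbabilityMeasure (Hw O)) : Continuous (SVg O G.pre n y μs) := by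
  unfold SVg Vbet Gambler.pre
  fun_prop

lemma isCompact_cyl (n : ℕ) (y : Hn O n) : IsCompact (cyl O n y) := by
  have hproj : Continuous (proj O n) := by
    unfold proj
    fun_prop
  exact (isClosed_singleton.preimage hproj).isCompact

lemma SVgMin_le_SVg (G : Gambler O) (n : ℕ) (y : Hn O (n-1))
    (μs : Fin n → ProbabilityMeasure (Hw O)) {x : Hw O} (hx : x ∈ cyl O (n-1) y) :
    SVgMin O G.pre n y μs ≤ SVg O G.pre n y μs x :=
  csInf_le ((isCompact_cyl _ y).image (continuous_SVg G n y μs)).bddBelow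
    (mem_image_of_mem _ hx)

lemma trunc_mem_cyl {m n : ℕ} (h : m ≤ n) {y : Hn O n} {x : Hw O} (hx : x ∈ cyl O n y) :
    x ∈ cyl O m (trunc O h y) := by
  have hx' : proj O n x = y := hx
  subst hx'
  rfl

lemma SVg_succ (G : PreGambler O) (n : ℕ) (y : Hn O n)
    (μs : Fin (n+1) → ProbabilityMeasure (Hw O)) (x : Hw O) :
    SVg O G (n+1) y μs x =
      SVg O G n (trunc O (Nat.sub_le n 1) y) (fun i => μs i.castSucc) x +
        Vbet (G n (y, fun i => μs i.castSucc)) (μs (Fin.last n)) x := by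
  unfold SVg
  rw [Fin.sum_univ_castSucc]
  rfl

/-- All initial segments of the history lie in the set `A_b G` on which the minimal total
payoff exceeds `-b`. -/
def WithinBudget (G : PreGambler O) (b : ℝ) (n : ℕ) (y : Hn O n)
    (μs : Fin n → ProbabilityMeasure (Hw O)) : Prop :=
  ∀ m : Fin n, -b < SVgMin O G (m.1+1) (trunc O m.isLt.le y)
    (fun i : Fin (m.1+1) => μs (i.castLE m.isLt))

lemma WithinBudget.of_succ {G : PreGambler O} {b : ℝ} {n : ℕ} {y : Hn O (n+1)}
    {μs : Fin (n+1) → ProbabilityMeasure (Hw O)} (h : WithinBudget G b (n+1) y μs) :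
    WithinBudget G b n (trunc O n.le_succ y) (fun i => μs i.castSucc) :=
  fun m => h m.castSucc

lemma WithinBudget.SVg_add_pos {G : Gambler O} {b : ℝ} (hb : 0 < b) {n : ℕ} {y : Hn O n}
    {μs : Fin n → ProbabilityMeasure (Hw O)} (h : WithinBudget G.pre b n y μs)
    {x : Hw O} (hx : x ∈ cyl O (n-1) (trunc O (Nat.sub_le n 1) y)) :
    0 < SVg O G.pre n (trunc O (Nat.sub_le n 1) y) μs x + b := by
  cases n with
  | zero => simpa [SVg] using hb
  | succ n =>
    have h₁ : -b < SVgMin O G.pre (n+1) (trunc O (Nat.sub_le (n+1) 1) y) μs := h (Fin.last n)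
    linarith [SVgMin_le_SVg G (n+1) _ μs hx]

lemma Vbet_BdG_of_withinBudget {G : PreGambler O} {b : ℝ} {n : ℕ} {y : Hn O n}
    {μs : Fin n → ProbabilityMeasure (Hw O)} (h : WithinBudget G b n y μs)
    (ν : ProbabilityMeasure (Hw O)) (x : Hw O) :
    Vbet (BdG O G b n (y, μs)) ν x = NrFun O G b n y μs ν * Vbet (G n (y, μs)) ν x := by
  have hG : BdG O G b n (y, μs) = fun p => NrFun O G b n y μs p.1 * G n (y, μs) p :=
    if_pos h
  rw [hG]
  simp only [Vbet, integral_const_mul]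
  ring

lemma Vbet_BdG_of_not_withinBudget {G : PreGambler O} {b : ℝ} {n : ℕ} {y : Hn O n}
    {μs : Fin n → ProbabilityMeasure (Hw O)} (h : ¬ WithinBudget G b n y μs)
    (ν : ProbabilityMeasure (Hw O)) (x : Hw O) :
    Vbet (BdG O G b n (y, μs)) ν x = 0 := by
  have hG : BdG O G b n (y, μs) = fun _ => 0 := if_neg h
  simp [hG, Vbet]

lemma NrFun_eq_one {G : Gambler O} {b : ℝ} (hb : 0 < b) {n : ℕ} {y : Hn O (n+1)}
    {μs : Fin (n+1) → ProbabilityMeasure (Hw O)} (h : WithinBudget G.pre b (n+1) y μs) :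
    NrFun O G.pre b n (trunc O n.le_succ y) (fun i => μs i.castSucc) (μs (Fin.last n)) = 1 := by
  unfold NrFun
  rw [max_eq_left, inv_one]
  refine Real.sSup_le ?_ zero_le_one
  rintro _ ⟨x, hx, rfl⟩
  have h₁ := h.of_succ.SVg_add_pos hb (trunc_mem_cyl (Nat.sub_le n 1) hx)
  have h₂ : 0 < SVg O G.pre (n+1) (trunc O n.le_succ y) μs x + b := h.SVg_add_pos hb hx
  rw [SVg_succ] at h₂
  rw [div_le_one h₁]
  linarith

lemma SVg_BdG_of_withinBudget {G : Gambler O} {b : ℝ} (hb : 0 < b) {n : ℕ} {y : Hn O n}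
    {μs : Fin n → ProbabilityMeasure (Hw O)} (h : WithinBudget G.pre b n y μs) (x : Hw O) :
    SVg O (BdG O G.pre b) n (trunc O (Nat.sub_le n 1) y) μs x =
      SVg O G.pre n (trunc O (Nat.sub_le n 1) y) μs x := by
  induction n with
  | zero => simp [SVg]
  | succ n ih =>
    change SVg O (BdG O G.pre b) (n+1) (trunc O n.le_succ y) μs x =
      SVg O G.pre (n+1) (trunc O n.le_succ y) μs x
    rw [SVg_succ, SVg_succ, ih h.of_succ, Vbet_BdG_of_withinBudget h.of_succ,
      NrFun_eq_one hb h, one_mul]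

lemma neg_le_NrFun_mul_Vbet {G : Gambler O} {b : ℝ} (hb : 0 < b) {n : ℕ} {y : Hn O n}
    {μs : Fin n → ProbabilityMeasure (Hw O)} (h : WithinBudget G.pre b n y μs)
    (ν : ProbabilityMeasure (Hw O)) {x : Hw O} (hx : x ∈ cyl O n y) :
    -(SVg O G.pre n (trunc O (Nat.sub_le n 1) y) μs x + b) ≤
      NrFun O G.pre b n y μs ν * Vbet (Gambler.pre O G n (y, μs)) ν x := by
  have hpos : ∀ x ∈ cyl O n y, 0 < SVg O G.pre n (trunc O (Nat.sub_le n 1) y) μs x + b :=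
    fun x hx => h.SVg_add_pos hb (trunc_mem_cyl _ hx)
  have hV : Continuous (Vbet (Gambler.pre O G n (y, μs)) ν) := by
    unfold Vbet Gambler.pre
    fun_prop
  have hbdd := ((isCompact_cyl n y).image_of_continuousOn (hV.neg.continuousOn.div
    ((continuous_SVg G n (trunc O (Nat.sub_le n 1) y) μs).add continuous_const).continuousOn
    fun x hx => (hpos x hx).ne')).bddAbove
  have hle := (div_le_iff₀ (hpos x hx)).mp
    ((le_csSup hbdd (mem_image_of_mem _ hx)).trans (le_max_right 1 _))
  unfold NrFun
  rw [inv_mul_eq_div, le_div_iff₀ (lt_of_lt_of_le one_pos (le_max_left _ _)), neg_mul,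
    neg_le, mul_comm]
  exact hle

lemma neg_le_SVg_BdG (G : Gambler O) {b : ℝ} (hb : 0 < b) (n : ℕ) (y : Hn O (n-1))
    (μs : Fin n → ProbabilityMeasure (Hw O)) {x : Hw O} (hx : x ∈ cyl O (n-1) y) :
    -b ≤ SVg O (BdG O G.pre b) n y μs x := by
  induction n with
  | zero => simpa [SVg] using hb.le
  | succ n ih =>
    change Hn O n at y
    change x ∈ cyl O n y at hx
    rw [SVg_succ]
    by_cases h : WithinBudget G.pre b n y (fun i => μs i.castSucc)
    · rw [SVg_BdG_of_withinBudget hb h, Vbet_BdG_of_withinBudget h]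
      linarith [neg_le_NrFun_mul_Vbet hb h (μs (Fin.last n)) hx]
    · rw [Vbet_BdG_of_not_withinBudget h, add_zero]
      exact ih _ _ (trunc_mem_cyl _ hx)

end BudgetedGambler

/-- Proposition 3.2 of the paper: the budgeted gambler `Bd_b G` never
loses more than its budget `b`. -/
theorem statement5 (G : Gambler O) (b : ℝ) (hb : 0 < b) (n : ℕ) (y : Hn O (n-1))
    (μs : Fin n → ProbabilityMeasure (Hw O)) :
    -b ≤ SVgMin O (BdG O G.pre b) n y μs := by
  refine Real.le_sInf ?_ (neg_nonpos.mpr hb.le)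
  rintro _ ⟨x, hx, rfl⟩
  exact neg_le_SVg_BdG G hb n y μs hx

end
end

section
/- Let G be a gambler and ζ : ℕ → (0,1] with b_ζ := Σ_{b=0}^∞ ζ(b)·b < ∞. Define the gambler Bd_ζ G := Σ_{b=1}^∞ ζ(b) · Bd_b G. Then SVmin (Bd_ζ G)_n ≥ −b_ζ for all n, y, μ̄; moreover, any forecaster F that dominates Bd_ζ G also dominates G. -/
open MeasureTheory Filter Set Topology
open scoped NNReal ENNReal

noncomputable section

variable (O : ℕ → Type*) [∀ n, TopologicalSpace (O n)] [∀ n, CompactSpace (O n)]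
  [∀ n, PolishSpace (O n)] [∀ n, MeasurableSpace (O n)] [∀ n, BorelSpace (O n)]

/-- The gambler `Bd_ζ G := Σ_{b=1}^∞ ζ(b) · Bd_b G`. -/
def BdZeta (G : PreGambler O) (ζ : ℕ → ℝ) : PreGambler O :=
  fun n yμ p => ∑' b : ℕ, ζ (b+1) * BdG O G ((b : ℝ)+1) n yμ p

section Budget

variable {X : Type*}

open scoped Classical in
/-- The factor by which the `n`-th payoff is scaled to enforce the budget `b`, for payoffs `v`
and feasible sets `K`. -/
def budgetCoef (K : ℕ → Set X) (v : ℕ → X → ℝ) (b : ℝ) (n : ℕ) : ℝ :=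
  if ∀ m < n, -b < sInf ((fun x => ∑ i ∈ Finset.range (m + 1), v i x) '' K m) then
    (max 1 (sSup ((fun x => -v n x / (∑ i ∈ Finset.range n, v i x + b)) '' K n)))⁻¹
  else 0

theorem budgetCoef_nonneg (K : ℕ → Set X) (v : ℕ → X → ℝ) (b : ℝ) (n : ℕ) :
    0 ≤ budgetCoef K v b n := by
  unfold budgetCoef
  split_ifs
  · exact inv_nonneg.2 (zero_le_one.trans (le_max_left _ _))
  · exact le_rfl

theorem budgetCoef_le_one (K : ℕ → Set X) (v : ℕ → X → ℝ) (b : ℝ) (n : ℕ) :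
    budgetCoef K v b n ≤ 1 := by
  unfold budgetCoef
  split_ifs
  · exact inv_le_one_of_one_le₀ (le_max_left _ _)
  · exact zero_le_one

theorem exists_abs_sum_range_le {v : ℕ → X → ℝ} (hv : ∀ n, ∃ C, ∀ x, |v n x| ≤ C) (n : ℕ) :
    ∃ C, ∀ x, |∑ i ∈ Finset.range n, v i x| ≤ C := by
  choose C hC using hv
  exact ⟨∑ i ∈ Finset.range n, C i, fun x =>
    (Finset.abs_sum_le_sum_abs _ _).trans (Finset.sum_le_sum fun i _ => hC i x)⟩

theorem bddBelow_image_of_abs_le {f : X → ℝ} (hf : ∃ C, ∀ x, |f x| ≤ C) (s : Set X) :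
    BddBelow (f '' s) := by
  obtain ⟨C, hC⟩ := hf
  refine ⟨-C, ?_⟩
  rintro _ ⟨x, -, rfl⟩
  exact (abs_le.1 (hC x)).1

theorem bddAbove_image_of_abs_le {f : X → ℝ} (hf : ∃ C, ∀ x, |f x| ≤ C) (s : Set X) :
    BddAbove (f '' s) := by
  obtain ⟨C, hC⟩ := hf
  refine ⟨C, ?_⟩
  rintro _ ⟨x, -, rfl⟩
  exact (abs_le.1 (hC x)).2

variable {K : ℕ → Set X} {v : ℕ → X → ℝ} {b : ℝ}

theorem sum_range_succ_gt_of_lt_sInf (hv : ∀ n, ∃ C, ∀ x, |v n x| ≤ C) {m : ℕ}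
    (h : -b < sInf ((fun x => ∑ i ∈ Finset.range (m + 1), v i x) '' K m)) {x : X} (hx : x ∈ K m) :
    -b < ∑ i ∈ Finset.range (m + 1), v i x :=
  h.trans_le (csInf_le (bddBelow_image_of_abs_le (exists_abs_sum_range_le hv _) _)
    (mem_image_of_mem _ hx))

theorem sum_range_add_pos (hK : Antitone K) (hv : ∀ n, ∃ C, ∀ x, |v n x| ≤ C) (hb : 0 < b)
    {n : ℕ} (h : ∀ m < n, -b < sInf ((fun x => ∑ i ∈ Finset.range (m + 1), v i x) '' K m))
    {x : X} (hx : x ∈ K n) : 0 < ∑ i ∈ Finset.range n, v i x + b := by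
  cases n with
  | zero => simpa using hb
  | succ m =>
    have := sum_range_succ_gt_of_lt_sInf hv (h m m.lt_succ_self) (hK m.le_succ hx)
    linarith

theorem budgetCoef_eq_one (hK : Antitone K) (hv : ∀ n, ∃ C, ∀ x, |v n x| ≤ C) (hb : 0 < b)
    {n : ℕ} (h : ∀ m ≤ n, -b < sInf ((fun x => ∑ i ∈ Finset.range (m + 1), v i x) '' K m)) :
    budgetCoef K v b n = 1 := by
  have h' := fun m (hm : m < n) => h m hm.le
  rw [budgetCoef, if_pos h', max_eq_left, inv_one]
  refine Real.sSup_le ?_ zero_le_one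
  rintro _ ⟨x, hx, rfl⟩
  have h1 := sum_range_add_pos hK hv hb h' hx
  have h2 := sum_range_succ_gt_of_lt_sInf hv (h n le_rfl) hx
  rw [Finset.sum_range_succ] at h2
  show -v n x / _ ≤ 1
  rw [div_le_one h1]
  linarith

/-- Payoffs scaled by `budgetCoef` never lose more than the budget. -/
theorem neg_le_sum_budgetCoef_mul (hK : Antitone K) (hv : ∀ n, ∃ C, ∀ x, |v n x| ≤ C)
    (hb : 0 < b) (n : ℕ) {x : X} (hx : x ∈ K (n - 1)) :
    -b ≤ ∑ i ∈ Finset.range n, budgetCoef K v b i * v i x := by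
  induction n with
  | zero => simpa using hb.le
  | succ n ih =>
    rw [Nat.add_sub_cancel] at hx
    rw [Finset.sum_range_succ]
    by_cases h : ∀ m < n, -b < sInf ((fun x => ∑ i ∈ Finset.range (m + 1), v i x) '' K m)
    · have hsum : ∑ i ∈ Finset.range n, budgetCoef K v b i * v i x
          = ∑ i ∈ Finset.range n, v i x := by
        refine Finset.sum_congr rfl fun i hi => ?_
        rw [budgetCoef_eq_one hK hv hb fun m hm => h m (hm.trans_lt (Finset.mem_range.1 hi)),
          one_mul]
      have hD := sum_range_add_pos hK hv hb h hx
      have hbdd : BddAbove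
          ((fun x => -v n x / (∑ i ∈ Finset.range n, v i x + b)) '' K n) := by
        obtain ⟨C, hC⟩ := hv n
        obtain ⟨d, hd, hdK⟩ : ∃ d > 0, ∀ y ∈ K n, d ≤ ∑ i ∈ Finset.range n, v i y + b := by
          cases n with
          | zero => exact ⟨b, hb, by simp⟩
          | succ m =>
            refine ⟨sInf ((fun x => ∑ i ∈ Finset.range (m + 1), v i x) '' K m) + b,
              by linarith [h m m.lt_succ_self], fun y hy => ?_⟩
            gcongr
            exact csInf_le (bddBelow_image_of_abs_le (exists_abs_sum_range_le hv _) _)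
              (mem_image_of_mem _ (hK m.le_succ hy))
        refine ⟨C / d, ?_⟩
        rintro _ ⟨y, hy, rfl⟩
        have hC0 : 0 ≤ C := (abs_nonneg _).trans (hC y)
        exact div_le_div₀ hC0 ((neg_le_abs _).trans (hC y)) hd (hdK y hy)
      have hle := le_csSup hbdd (mem_image_of_mem _ hx)
      rw [hsum, budgetCoef, if_pos h]
      set s := sSup ((fun x => -v n x / (∑ i ∈ Finset.range n, v i x + b)) '' K n)
      have hM : 0 < max 1 s := zero_lt_one.trans_le (le_max_left _ _)
      have h1 : -v n x / (∑ i ∈ Finset.range n, v i x + b) ≤ max 1 s :=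
        hle.trans (le_max_right _ _)
      rw [div_le_iff₀ hD, ← div_le_iff₀' hM, div_eq_inv_mul] at h1
      linarith
    · rw [budgetCoef, if_neg h, zero_mul, add_zero]
      exact ih (hK (Nat.sub_le n 1) hx)

end Budget

theorem cyl_proj_antitone (x : Hw O) : Antitone fun n => cyl O n (proj O n x) := by
  intro m n hmn z hz
  funext i
  exact congrFun hz (i.castLE hmn)

/-- The payoff of the `n`-th bet along the observations `x` and the forecasts `μ`. -/
def payoff (G : PreGambler O) (x : Hw O) (μ : ℕ → ProbabilityMeasure (Hw O)) (n : ℕ) (z : Hw O) :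
    ℝ :=
  Vbet (G n (proj O n x, fun i : Fin n => μ i)) (μ n) z

theorem SVg_proj (G : PreGambler O) (x : Hw O) (μ : ℕ → ProbabilityMeasure (Hw O)) (n : ℕ)
    (z : Hw O) :
    SVg O G n (proj O (n - 1) x) (fun i : Fin n => μ i) z
      = ∑ m ∈ Finset.range n, payoff O G x μ m z :=
  Fin.sum_univ_eq_sum_range (fun m => payoff O G x μ m z) n

theorem SVf_eq_sum_payoff (G : PreGambler O) (F : ∀ n, Hn O n → ProbabilityMeasure (Hw O))
    (x : Hw O) (n : ℕ) {z : Hw O} (hz : z ∈ cyl O (n - 1) (proj O (n - 1) x)) :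
    SVf O G F n z = ∑ m ∈ Finset.range n, payoff O G x (fun m => F m (proj O m x)) m z := by
  have h : SVf O G F n z
      = ∑ m ∈ Finset.range n, payoff O G z (fun m => F m (proj O m z)) m z :=
    Fin.sum_univ_eq_sum_range (fun m => payoff O G z (fun m => F m (proj O m z)) m z) n
  rw [h]
  refine Finset.sum_congr rfl fun m hm => ?_
  have hp : ∀ k ≤ m, proj O k z = proj O k x := fun k hk =>
    cyl_proj_antitone O x (hk.trans (Nat.le_pred_of_lt (Finset.mem_range.1 hm))) hz
  have hμ : (fun i : Fin m => F i (proj O i z)) = fun i : Fin m => F i (proj O i x) :=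
    funext fun i => by rw [hp i i.isLt.le]
  simp only [payoff]
  rw [hμ, hp m le_rfl]

theorem BdG_proj (G : PreGambler O) (b : ℝ) (x : Hw O) (μ : ℕ → ProbabilityMeasure (Hw O))
    (n : ℕ) (z : Hw O) :
    BdG O G b n (proj O n x, fun i : Fin n => μ i) (μ n, z)
      = budgetCoef (fun n => cyl O n (proj O n x)) (payoff O G x μ) b n
        * G n (proj O n x, fun i : Fin n => μ i) (μ n, z) := by
  have hiff : (∀ m : Fin n, -b < SVgMin O G (m.1+1) (trunc O m.isLt.le (proj O n x))
      (fun i : Fin (m.1+1) => μ i)) ↔ ∀ m < n, -b < sInf ((fun z =>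
        ∑ i ∈ Finset.range (m + 1), payoff O G x μ i z) '' cyl O m (proj O m x)) := by
    rw [Fin.forall_iff]
    refine forall₂_congr fun m hm => ?_
    simp only [← SVg_proj]
    exact Iff.rfl
  have hNr : NrFun O G b n (proj O n x) (fun i : Fin n => μ i) (μ n)
      = (max 1 (sSup ((fun z => -payoff O G x μ n z /
        (∑ i ∈ Finset.range n, payoff O G x μ i z + b)) '' cyl O n (proj O n x))))⁻¹ := by
    simp only [← SVg_proj]
    rfl
  unfold BdG budgetCoef
  by_cases h : ∀ m < n, -b < sInf ((fun z =>
        ∑ i ∈ Finset.range (m + 1), payoff O G x μ i z) '' cyl O m (proj O m x))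
  · rw [if_pos h, ← hNr]
    exact congrFun (if_pos (hiff.2 h)) _
  · rw [if_neg h, zero_mul]
    exact congrFun (if_neg fun h' => h (hiff.1 h')) _

theorem payoff_BdZeta (G : PreGambler O) (ζ : ℕ → ℝ) (x : Hw O)
    (μ : ℕ → ProbabilityMeasure (Hw O)) (n : ℕ) (z : Hw O) :
    payoff O (BdZeta O G ζ) x μ n z
      = (∑' b : ℕ, ζ (b + 1) * budgetCoef (fun n => cyl O n (proj O n x)) (payoff O G x μ)
          ((b : ℝ) + 1) n) * payoff O G x μ n z := by
  have h : ∀ w, BdZeta O G ζ n (proj O n x, fun i : Fin n => μ i) (μ n, w)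
      = (∑' b : ℕ, ζ (b + 1) * budgetCoef (fun n => cyl O n (proj O n x)) (payoff O G x μ)
          ((b : ℝ) + 1) n) * G n (proj O n x, fun i : Fin n => μ i) (μ n, w) := fun w => by
    simp only [BdZeta, BdG_proj, ← mul_assoc, tsum_mul_right]
  rw [payoff, Vbet]
  simp only [h]
  rw [integral_const_mul, ← mul_sub]
  rfl

theorem exists_abs_payoff_le (G : Gambler O) (x : Hw O) (μ : ℕ → ProbabilityMeasure (Hw O))
    (n : ℕ) : ∃ C, ∀ z, |payoff O G.pre x μ n z| ≤ C := by
  have hc : Continuous (payoff O G.pre x μ n) := by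
    have : Continuous fun z => G.G n (proj O n x, fun i : Fin n => μ i) (μ n, z) := by fun_prop
    exact this.sub continuous_const
  obtain ⟨C, hC⟩ := isCompact_univ.exists_bound_of_continuousOn hc.continuousOn
  exact ⟨C, fun z => hC z (mem_univ z)⟩

theorem exists_abs_payoff_BdZeta_le (G : Gambler O) (ζ : ℕ → ℝ) (x : Hw O)
    (μ : ℕ → ProbabilityMeasure (Hw O)) (n : ℕ) :
    ∃ C, ∀ z, |payoff O (BdZeta O G.pre ζ) x μ n z| ≤ C := by
  obtain ⟨C, hC⟩ := exists_abs_payoff_le O G x μ n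
  refine ⟨|∑' b : ℕ, ζ (b + 1) * budgetCoef (fun n => cyl O n (proj O n x))
    (payoff O G.pre x μ) ((b : ℝ) + 1) n| * C, fun z => ?_⟩
  rw [payoff_BdZeta, abs_mul]
  exact mul_le_mul_of_nonneg_left (hC z) (abs_nonneg _)

/-- The total payoff of `Bd_ζ G` is the `ζ`-weighted sum of the total payoffs of the gamblers
`Bd_b G`. -/
theorem hasSum_payoff_BdZeta (G : PreGambler O) {ζ : ℕ → ℝ} (hζ : ∀ b, 0 ≤ ζ b)
    (hsum : Summable fun b : ℕ => ζ b * b) (x : Hw O) (μ : ℕ → ProbabilityMeasure (Hw O))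
    (n : ℕ) (z : Hw O) :
    HasSum (fun b : ℕ => ζ (b + 1) * ∑ m ∈ Finset.range n,
        budgetCoef (fun n => cyl O n (proj O n x)) (payoff O G x μ) ((b : ℝ) + 1) m
          * payoff O G x μ m z)
      (∑ m ∈ Finset.range n, payoff O (BdZeta O G ζ) x μ m z) := by
  have hs : Summable fun b : ℕ => ζ (b + 1) := by
    refine ((summable_nat_add_iff 1).2 hsum).of_nonneg_of_le (fun b => hζ _) fun b => ?_
    have : (1 : ℝ) ≤ ((b + 1 : ℕ) : ℝ) := by exact_mod_cast Nat.le_add_left 1 b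
    exact le_mul_of_one_le_right (hζ _) this
  simp only [Finset.mul_sum, payoff_BdZeta, ← mul_assoc]
  refine hasSum_sum fun m _ => HasSum.mul_right _ (Summable.hasSum ?_)
  refine hs.of_nonneg_of_le (fun b => mul_nonneg (hζ _) (budgetCoef_nonneg _ _ _ _)) fun b => ?_
  exact mul_le_of_le_one_right (hζ _) (budgetCoef_le_one _ _ _ _)

theorem hasSum_succ_mul {ζ : ℕ → ℝ} (hsum : Summable fun b : ℕ => ζ b * b) :
    HasSum (fun b : ℕ => ζ (b + 1) * ((b : ℝ) + 1)) (∑' b : ℕ, ζ b * b) := by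
  have := (hasSum_nat_add_iff' 1).2 hsum.hasSum
  simpa using this

theorem mul_budget_payoff_le (G : Gambler O) {ζ : ℕ → ℝ} (hζ : ∀ b, 0 ≤ ζ b)
    (hsum : Summable fun b : ℕ => ζ b * b) (x : Hw O) (μ : ℕ → ProbabilityMeasure (Hw O))
    (n : ℕ) {z : Hw O} (hz : z ∈ cyl O (n - 1) (proj O (n - 1) x)) (b : ℕ) :
    0 ≤ ζ (b + 1) * (∑ m ∈ Finset.range n, budgetCoef (fun n => cyl O n (proj O n x))
        (payoff O G.pre x μ) ((b : ℝ) + 1) m * payoff O G.pre x μ m z + (b + 1)) ∧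
    ζ (b + 1) * (∑ m ∈ Finset.range n, budgetCoef (fun n => cyl O n (proj O n x))
        (payoff O G.pre x μ) ((b : ℝ) + 1) m * payoff O G.pre x μ m z + (b + 1)) ≤
      ∑ m ∈ Finset.range n, payoff O (BdZeta O G.pre ζ) x μ m z + ∑' b : ℕ, ζ b * b := by
  have hnn : ∀ b : ℕ, 0 ≤ ζ (b + 1) * (∑ m ∈ Finset.range n,
      budgetCoef (fun n => cyl O n (proj O n x))
        (payoff O G.pre x μ) ((b : ℝ) + 1) m * payoff O G.pre x μ m z + (b + 1)) := fun b => by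
    refine mul_nonneg (hζ _) ?_
    have := neg_le_sum_budgetCoef_mul (b := (b : ℝ) + 1) (cyl_proj_antitone O x)
      (exists_abs_payoff_le O G x μ) (by positivity) n hz
    linarith
  have hs := (hasSum_payoff_BdZeta O G.pre hζ hsum x μ n z).add (hasSum_succ_mul hsum)
  simp only [← mul_add] at hs
  exact ⟨hnn b, le_hasSum hs b fun j _ => hnn j⟩

theorem neg_le_sum_payoff_BdZeta (G : Gambler O) {ζ : ℕ → ℝ} (hζ : ∀ b, 0 ≤ ζ b)
    (hsum : Summable fun b : ℕ => ζ b * b) (x : Hw O) (μ : ℕ → ProbabilityMeasure (Hw O))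
    (n : ℕ) {z : Hw O} (hz : z ∈ cyl O (n - 1) (proj O (n - 1) x)) :
    -(∑' b : ℕ, ζ b * b) ≤ ∑ m ∈ Finset.range n, payoff O (BdZeta O G.pre ζ) x μ m z := by
  obtain ⟨h1, h2⟩ := mul_budget_payoff_le O G hζ hsum x μ n hz 0
  linarith

/-- Proposition 3.3 of the paper: for `ζ : ℕ → (0,1]` with
`b_ζ := Σ_b ζ(b)·b < ∞`, the gambler `Bd_ζ G` never loses more than `b_ζ`, and any
forecaster dominating `Bd_ζ G` also dominates `G`. -/
theorem statement6 (G : Gambler O) (ζ : ℕ → ℝ) (hζ : ∀ b, ζ b ∈ Set.Ioc (0:ℝ) 1)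
    (hsum : Summable fun b : ℕ => ζ b * b) :
    (∀ (n : ℕ) (y : Hn O (n-1)) (μs : Fin n → ProbabilityMeasure (Hw O)),
      -(∑' b : ℕ, ζ b * b) ≤ SVgMin O (BdZeta O G.pre ζ) n y μs) ∧
    (∀ F : Forecaster O, Dominates O F.F (BdZeta O G.pre ζ) → Dominates O F.F G.pre) := by
  have hζ0 : ∀ b, 0 ≤ ζ b := fun b => (hζ b).1.le
  refine ⟨fun n y μs => ?_, fun F hF x ⟨L, hL⟩ => ?_⟩
  · rcases (cyl O (n - 1) y).eq_empty_or_nonempty with he | ⟨x, rfl⟩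
    · rw [SVgMin, he, image_empty, Real.sInf_empty, neg_nonpos]
      exact tsum_nonneg fun b => mul_nonneg (hζ0 b) b.cast_nonneg
    · refine le_csInf ⟨_, mem_image_of_mem _ (rfl : x ∈ cyl O (n - 1) (proj O (n - 1) x))⟩ ?_
      rintro _ ⟨z, hz, rfl⟩
      obtain ⟨μ, rfl⟩ : ∃ μ : ℕ → ProbabilityMeasure (Hw O), μs = fun i : Fin n => μ i := by
        refine ⟨fun i => if h : i < n then μs ⟨i, h⟩ else ⟨Measure.dirac x, inferInstance⟩, ?_⟩
        funext i
        simp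
      rw [SVg_proj]
      exact neg_le_sum_payoff_BdZeta O G hζ0 hsum x μ n hz
  · set μ : ℕ → ProbabilityMeasure (Hw O) := fun m => F.F m (proj O m x)
    have hmem : ∀ n, x ∈ cyl O n (proj O n x) := fun n => rfl
    have himage : ∀ (H : PreGambler O) (n : ℕ),
        SVf O H F.F n '' cyl O (n - 1) (proj O (n - 1) x)
          = (fun z => ∑ m ∈ Finset.range n, payoff O H x μ m z) ''
            cyl O (n - 1) (proj O (n - 1) x) := fun H n =>
      image_congr fun z hz => SVf_eq_sum_payoff O H F.F x n hz
    obtain ⟨U, hU⟩ := hF x (by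
      refine ⟨-(∑' b : ℕ, ζ b * b), ?_⟩
      rintro _ ⟨n, rfl⟩
      simp only [SVfMin, himage]
      refine le_csInf ⟨_, mem_image_of_mem _ (hmem (n - 1))⟩ ?_
      rintro _ ⟨z, hz, rfl⟩
      exact neg_le_sum_payoff_BdZeta O G hζ0 hsum x μ n hz)
    obtain ⟨b, hb⟩ := exists_nat_gt (-L)
    refine ⟨(U + ∑' b : ℕ, ζ b * b) / ζ (b + 1), ?_⟩
    rintro _ ⟨n, rfl⟩
    simp only [SVfMax, himage]
    refine csSup_le ⟨_, mem_image_of_mem _ (hmem (n - 1))⟩ ?_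
    rintro _ ⟨z, hz, rfl⟩
    have hcoef : ∀ m, budgetCoef (fun n => cyl O n (proj O n x)) (payoff O G.pre x μ)
        ((b : ℝ) + 1) m = 1 := fun m => by
      refine budgetCoef_eq_one (cyl_proj_antitone O x) (exists_abs_payoff_le O G x μ)
        (by positivity) fun k _ => ?_
      have hk : L ≤ SVfMin O G.pre F.F (k + 1) (proj O (k + 1 - 1) x) := hL ⟨k + 1, rfl⟩
      rw [SVfMin, himage] at hk
      exact lt_of_lt_of_le (by linarith) hk
    have hle := (mul_budget_payoff_le O G hζ0 hsum x μ n hz b).2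
    simp only [hcoef, one_mul] at hle
    have hUz : ∑ m ∈ Finset.range n, payoff O (BdZeta O G.pre ζ) x μ m z ≤ U := by
      have hn : SVfMax O (BdZeta O G.pre ζ) F.F n (proj O (n - 1) x) ≤ U := hU ⟨n, rfl⟩
      rw [SVfMax, himage] at hn
      exact (le_csSup (bddAbove_image_of_abs_le (exists_abs_sum_range_le
        (exists_abs_payoff_BdZeta_le O G ζ x μ) n) _) (mem_image_of_mem _ hz)).trans hn
    rw [le_div_iff₀ (hζ (b + 1)).1, mul_comm]
    have hpos : 0 ≤ ζ (b + 1) * ((b : ℝ) + 1) := mul_nonneg (hζ0 _) (by positivity)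
    rw [mul_add] at hle
    linarith

end
end

section
/- Let Ω be a probability space, (𝓕_n) a filtration, α, M > 0, and (X_n), (Y_n) stochastic processes adapted to (𝓕_n) with X_n real-valued and Y_n taking values in [0,M]. Assume: (i) E[|X_0|] < ∞; (ii) for all n ≤ m, almost surely |X_n − X_m| ≤ Σ_{l=n}^{m−1} Y_l + M; (iii) almost surely E[X_{n+1} | 𝓕_n] ≥ X_n + α·Y_n. Then for almost every ω: inf_n X_n(ω) > −∞, and if sup_n X_n(ω) < +∞ then Σ_n Y_n(ω) < +∞. -/
open MeasureTheory

/-- The reference value and accumulated weight of the block containing the current time: a block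
of the path `x` is closed, and a new one started, as soon as the weights `y` accumulated in it
reach `M`. -/
noncomputable def blockState (M : ℝ) (x y : ℕ → ℝ) : ℕ → ℝ × ℝ
  | 0 => (x 0, 0)
  | n + 1 =>
    if M ≤ (blockState M x y n).2 + y n then (x (n + 1), 0)
    else ((blockState M x y n).1, (blockState M x y n).2 + y n)

/-- A linear correction of `exp (-c * x n)` along blocks. -/
noncomputable def blockPotential (M c α : ℝ) (x y : ℕ → ℝ) (n : ℕ) : ℝ :=
  Real.exp (-c * ((blockState M x y n).1 - x 0)) *
    (1 - c * (x n - (blockState M x y n).1) + c * α * (blockState M x y n).2)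

/-- The value which `blockPotential` takes at time `n + 1` when no block is closed at that time. -/
noncomputable def blockPotentialNext (M c α : ℝ) (x y : ℕ → ℝ) (n : ℕ) : ℝ :=
  Real.exp (-c * ((blockState M x y n).1 - x 0)) *
    (1 - c * (x (n + 1) - (blockState M x y n).1) + c * α * ((blockState M x y n).2 + y n))

section Deterministic

variable {M c α : ℝ} {x y : ℕ → ℝ}

lemma exists_blockState_eq (hM : 0 < M) (hy : ∀ n, y n ∈ Set.Icc 0 M) (n : ℕ) :
    0 ≤ (blockState M x y n).2 ∧ (blockState M x y n).2 < M ∧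
      ∃ k ≤ n, (blockState M x y n).1 = x k ∧
        (blockState M x y n).2 = ∑ l ∈ Finset.Ico k n, y l := by
  induction n with
  | zero => exact ⟨le_rfl, hM, 0, le_rfl, rfl, by simp [blockState]⟩
  | succ n ih =>
    obtain ⟨h0, h1, k, hk, hr, hs⟩ := ih
    by_cases h : M ≤ (blockState M x y n).2 + y n
    · simp only [blockState, h, if_true]
      exact ⟨le_rfl, hM, n + 1, le_rfl, rfl, by simp⟩
    · simp only [blockState, h, if_false]
      refine ⟨add_nonneg h0 (hy n).1, not_le.1 h, k, hk.trans n.le_succ, hr, ?_⟩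
      rw [Finset.sum_Ico_succ_top hk, hs]

lemma abs_sub_blockState_le (hM : 0 < M) (hy : ∀ n, y n ∈ Set.Icc 0 M)
    (hx : ∀ n m, n ≤ m → |x n - x m| ≤ (∑ l ∈ Finset.Ico n m, y l) + M) (n : ℕ) :
    |x n - (blockState M x y n).1| ≤ 2 * M := by
  obtain ⟨h0, h1, k, hk, hr, hs⟩ := exists_blockState_eq (x := x) hM hy n
  rw [hr, abs_sub_comm]
  linarith [hx k n hk]

lemma abs_succ_sub_blockState_le (hM : 0 < M) (hy : ∀ n, y n ∈ Set.Icc 0 M)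
    (hx : ∀ n m, n ≤ m → |x n - x m| ≤ (∑ l ∈ Finset.Ico n m, y l) + M) (n : ℕ) :
    |x (n + 1) - (blockState M x y n).1| ≤ 3 * M := by
  obtain ⟨h0, h1, k, hk, hr, hs⟩ := exists_blockState_eq (x := x) hM hy n
  have h := hx k (n + 1) (hk.trans n.le_succ)
  rw [Finset.sum_Ico_succ_top hk, ← hs] at h
  rw [hr, abs_sub_comm]
  linarith [(hy n).2]

lemma abs_sub_zero_le (hy : ∀ n, y n ∈ Set.Icc 0 M)
    (hx : ∀ n m, n ≤ m → |x n - x m| ≤ (∑ l ∈ Finset.Ico n m, y l) + M) (n : ℕ) :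
    |x n - x 0| ≤ n * M + M := by
  rw [abs_sub_comm]
  refine (hx 0 n n.zero_le).trans (add_le_add_left ?_ M)
  refine (Finset.sum_le_sum fun l _ => (hy l).2).trans ?_
  simp

lemma abs_succ_sub_le (hy : ∀ n, y n ∈ Set.Icc 0 M)
    (hx : ∀ n m, n ≤ m → |x n - x m| ≤ (∑ l ∈ Finset.Ico n m, y l) + M) (n : ℕ) :
    |x (n + 1) - x n| ≤ 2 * M := by
  have h := hx n (n + 1) n.le_succ
  rw [abs_sub_comm]
  simp only [Nat.Ico_succ_singleton, Finset.sum_singleton] at h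
  linarith [(hy n).2]

lemma exp_le_two_mul_blockPotential (hM : 0 < M) (hα : 0 < α) (hc : 0 < c) (hcM : c * (6 * M) ≤ 1)
    (hy : ∀ n, y n ∈ Set.Icc 0 M)
    (hx : ∀ n m, n ≤ m → |x n - x m| ≤ (∑ l ∈ Finset.Ico n m, y l) + M) (n : ℕ) :
    Real.exp (-c * ((blockState M x y n).1 - x 0)) ≤ 2 * blockPotential M c α x y n := by
  have hd := (abs_le.1 (abs_sub_blockState_le hM hy hx n)).2
  have hs := (exists_blockState_eq (x := x) hM hy n).1
  have h1 : c * (x n - (blockState M x y n).1) ≤ c * (2 * M) :=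
    mul_le_mul_of_nonneg_left hd hc.le
  have h2 : 0 ≤ c * α * (blockState M x y n).2 := by positivity
  rw [blockPotential]
  nlinarith [Real.exp_pos (-c * ((blockState M x y n).1 - x 0)), mul_pos hc hM]

lemma blockPotential_succ_le (hM : 0 < M) (hc : 0 < c) (hcM : c * (6 * M) ≤ 1)
    (hcα : c * (9 * M) ≤ α) (hy : ∀ n, y n ∈ Set.Icc 0 M)
    (hx : ∀ n m, n ≤ m → |x n - x m| ≤ (∑ l ∈ Finset.Ico n m, y l) + M) (n : ℕ) :
    blockPotential M c α x y (n + 1) ≤ blockPotentialNext M c α x y n := by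
  by_cases h : M ≤ (blockState M x y n).2 + y n
  · have hd := abs_succ_sub_blockState_le hM hy hx n
    simp only [blockPotential, blockPotentialNext, blockState, h, if_true]
    set r := (blockState M x y n).1
    set s := (blockState M x y n).2
    set d := x (n + 1) - r with hd_def
    have hsplit : -c * (x (n + 1) - x 0) = -c * (r - x 0) + -c * d := by rw [hd_def]; ring
    rw [hsplit, Real.exp_add, mul_assoc]
    refine mul_le_mul_of_nonneg_left ?_ (Real.exp_pos _).le
    have hcd : |-c * d| ≤ c * (3 * M) := by
      rw [abs_mul, abs_neg, abs_of_pos hc]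
      exact mul_le_mul_of_nonneg_left hd hc.le
    have hcM0 : 0 < c * M := mul_pos hc hM
    have hexp := (abs_le.1 (Real.abs_exp_sub_one_sub_id_le (x := -c * d) (by linarith))).2
    have hsq : (-c * d) ^ 2 ≤ (c * (3 * M)) ^ 2 := sq_le_sq' (abs_le.1 hcd).1 (abs_le.1 hcd).2
    have h1 : (c * (3 * M)) ^ 2 ≤ c * α * M := by
      have := mul_le_mul_of_nonneg_left hcα hcM0.le
      nlinarith
    have hα : 0 < c * α := mul_pos hc (lt_of_lt_of_le (by positivity) hcα)
    have h2 : c * α * M ≤ c * α * (s + y n) := mul_le_mul_of_nonneg_left h hα.le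
    simp only [sub_self, mul_zero]
    linarith
  · simp only [blockPotential, blockPotentialNext, blockState, h, if_false, le_refl]

lemma bddBelow_of_blockPotential_le (hM : 0 < M) (hα : 0 < α) (hc : 0 < c)
    (hcM : c * (6 * M) ≤ 1) (hy : ∀ n, y n ∈ Set.Icc 0 M)
    (hx : ∀ n m, n ≤ m → |x n - x m| ≤ (∑ l ∈ Finset.Ico n m, y l) + M) {K : ℝ}
    (hK : ∀ n, blockPotential M c α x y n ≤ K) : BddBelow (Set.range x) := by
  refine ⟨x 0 - 2 * K / c - 2 * M, ?_⟩
  rintro _ ⟨n, rfl⟩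
  have h1 := exp_le_two_mul_blockPotential hM hα hc hcM hy hx n
  have h2 := Real.add_one_le_exp (-c * ((blockState M x y n).1 - x 0))
  have h3 := (abs_le.1 (abs_sub_blockState_le hM hy hx n)).1
  have h4 : -((blockState M x y n).1 - x 0) ≤ 2 * K / c := by
    rw [le_div_iff₀ hc]
    linarith [hK n]
  linarith

end Deterministic

section Random

variable {Ω : Type*} {m0 : MeasurableSpace Ω} {P : Measure Ω} {𝓕 : Filtration ℕ m0}
  {α M c : ℝ} {X Y : ℕ → Ω → ℝ}

lemma measurable_blockState (hX : Adapted 𝓕 X) (hY : Adapted 𝓕 Y) (n : ℕ) :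
    Measurable[𝓕 n] fun ω => blockState M (X · ω) (Y · ω) n := by
  induction n with
  | zero => exact (hX 0).prodMk measurable_const
  | succ n ih =>
    have ih' := ih.mono (𝓕.mono n.le_succ) le_rfl
    have hY' := (hY n).mono (𝓕.mono n.le_succ) le_rfl
    have hs := (measurable_snd.comp ih').add hY'
    exact Measurable.ite (measurableSet_le measurable_const hs)
      ((hX (n + 1)).prodMk measurable_const) ((measurable_fst.comp ih').prodMk hs)

lemma condExp_sub_mul_le [IsFiniteMeasure P] {m : MeasurableSpace Ω} (hm : m ≤ m0)
    {f g h k : Ω → ℝ} {b : ℝ} (hf : StronglyMeasurable[m] f) (hg : StronglyMeasurable[m] g)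
    (hf_int : Integrable f P) (hh : Integrable h P) (hg0 : ∀ ω, 0 ≤ g ω)
    (hgb : ∀ᵐ ω ∂P, ‖g ω‖ ≤ b) (hk : ∀ᵐ ω ∂P, k ω ≤ (P[h | m]) ω) :
    P[f - g * h | m] ≤ᵐ[P] f - g * k := by
  have hgh : Integrable (g * h) P := hh.bdd_mul (hg.mono hm).aestronglyMeasurable hgb
  filter_upwards [condExp_sub hf_int hgh m, condExp_stronglyMeasurable_mul_of_bound hm hg hh b hgb,
    hk] with ω h1 h2 h3
  rw [h1, Pi.sub_apply, h2, condExp_of_stronglyMeasurable hm hf hf_int]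
  simp only [Pi.sub_apply, Pi.mul_apply]
  linarith [mul_le_mul_of_nonneg_left h3 (hg0 ω)]

lemma integrable_of_ae_bound [IsFiniteMeasure P] (hX : Adapted 𝓕 X) (hX0 : Integrable (X 0) P)
    (hYmem : ∀ n ω, Y n ω ∈ Set.Icc (0:ℝ) M)
    (hbd : ∀ᵐ ω ∂P, ∀ n m, n ≤ m →
      |X n ω - X m ω| ≤ (∑ l ∈ Finset.Ico n m, Y l ω) + M) (n : ℕ) :
    Integrable (X n) P := by
  have h : Integrable (X n - X 0) P := by
    refine Integrable.of_bound (C := n * M + M) ?_ ?_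
    · exact (((hX n).mono (𝓕.le n) le_rfl).sub
        ((hX 0).mono (𝓕.le 0) le_rfl)).aestronglyMeasurable
    · filter_upwards [hbd] with ω hω
      exact abs_sub_zero_le (fun n => hYmem n ω) hω n
  simpa using h.add hX0

lemma ae_bound_exp_blockState (hM : 0 < M) (hc : 0 < c)
    (hYmem : ∀ n ω, Y n ω ∈ Set.Icc (0:ℝ) M)
    (hbd : ∀ᵐ ω ∂P, ∀ n m, n ≤ m →
      |X n ω - X m ω| ≤ (∑ l ∈ Finset.Ico n m, Y l ω) + M) (n : ℕ) :
    ∀ᵐ ω ∂P, ‖Real.exp (-c * ((blockState M (X · ω) (Y · ω) n).1 - X 0 ω))‖ ≤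
      Real.exp (c * (n * M + M + 2 * M)) := by
  filter_upwards [hbd] with ω hω
  rw [Real.norm_eq_abs, Real.abs_exp, Real.exp_le_exp]
  have h1 := (abs_le.1 (abs_sub_blockState_le hM (fun n => hYmem n ω) hω n)).2
  have h2 := (abs_le.1 (abs_sub_zero_le (fun n => hYmem n ω) hω n)).1
  nlinarith

lemma supermartingale_blockPotential [IsFiniteMeasure P] (hM : 0 < M) (hc : 0 < c)
    (hcM : c * (6 * M) ≤ 1) (hcα : c * (9 * M) ≤ α) (hX : Adapted 𝓕 X) (hY : Adapted 𝓕 Y)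
    (hYmem : ∀ n ω, Y n ω ∈ Set.Icc (0:ℝ) M) (hX0 : Integrable (X 0) P)
    (hbd : ∀ᵐ ω ∂P, ∀ n m, n ≤ m →
      |X n ω - X m ω| ≤ (∑ l ∈ Finset.Ico n m, Y l ω) + M)
    (hsub : ∀ n, ∀ᵐ ω ∂P, X n ω + α * Y n ω ≤ (P[X (n+1) | 𝓕 n]) ω) :
    Supermartingale (fun n ω => blockPotential M c α (X · ω) (Y · ω) n) 𝓕 P := by
  set R : ℕ → Ω → ℝ := fun n ω => (blockState M (X · ω) (Y · ω) n).1 with hR_def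
  set S : ℕ → Ω → ℝ := fun n ω => (blockState M (X · ω) (Y · ω) n).2 with hS_def
  set E : ℕ → Ω → ℝ := fun n ω => Real.exp (-c * (R n ω - X 0 ω)) with hE_def
  have hR n : Measurable[𝓕 n] (R n) := measurable_fst.comp (measurable_blockState hX hY n)
  have hS n : Measurable[𝓕 n] (S n) := measurable_snd.comp (measurable_blockState hX hY n)
  have hE n : Measurable[𝓕 n] (E n) := Real.measurable_exp.comp
    (((hR n).sub ((hX 0).mono (𝓕.mono n.zero_le) le_rfl)).const_mul (-c))
  have hE_bound n := ae_bound_exp_blockState (c := c) hM hc hYmem hbd n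
  have hXint := integrable_of_ae_bound hX hX0 hYmem hbd
  have hE_mul {f : Ω → ℝ} (n : ℕ) (hf : Integrable f P) : Integrable (E n * f) P :=
    hf.bdd_mul ((hE n).mono (𝓕.le n) le_rfl).aestronglyMeasurable (hE_bound n)
  have hRint n : Integrable (R n) P := by
    have h : Integrable (X n - R n) P := by
      refine Integrable.of_bound (C := 2 * M) ?_ ?_
      · exact (((hX n).mono (𝓕.le n) le_rfl).sub
          ((hR n).mono (𝓕.le n) le_rfl)).aestronglyMeasurable
      · filter_upwards [hbd] with ω hω
        exact abs_sub_blockState_le hM (fun n => hYmem n ω) hω n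
    simpa using (hXint n).sub h
  have hSint n : Integrable (S n) P := by
    refine Integrable.of_bound (C := M) ((hS n).mono (𝓕.le n) le_rfl).aestronglyMeasurable
      (ae_of_all _ fun ω => ?_)
    have h := exists_blockState_eq (x := (X · ω)) hM (fun n => hYmem n ω) n
    rw [Real.norm_eq_abs, abs_of_nonneg h.1]
    exact h.2.1.le
  have hYint n : Integrable (Y n) P := by
    refine Integrable.of_bound (C := M) ((hY n).mono (𝓕.le n) le_rfl).aestronglyMeasurable
      (ae_of_all _ fun ω => ?_)
    rw [Real.norm_eq_abs, abs_of_nonneg (hYmem n ω).1]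
    exact (hYmem n ω).2
  have hV_meas n : Measurable[𝓕 n] fun ω => blockPotential M c α (X · ω) (Y · ω) n :=
    (hE n).mul ((measurable_const.sub (((hX n).sub (hR n)).const_mul c)).add
      ((hS n).const_mul (c * α)))
  have hV_int n : Integrable (fun ω => blockPotential M c α (X · ω) (Y · ω) n) P :=
    hE_mul n (((integrable_const 1).sub (((hXint n).sub (hRint n)).const_mul c)).add
      ((hSint n).const_mul (c * α)))
  refine supermartingale_nat (fun n => (hV_meas n).stronglyMeasurable) hV_int fun n => ?_
  set f : Ω → ℝ := E n * fun ω => 1 + c * R n ω + c * α * (S n ω + Y n ω) with hf_def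
  set g : Ω → ℝ := fun ω => c * E n ω with hg_def
  have hf : Measurable[𝓕 n] f := (hE n).mul ((((hR n).const_mul c).const_add 1).add
    (((hS n).add (hY n)).const_mul (c * α)))
  have hg : Measurable[𝓕 n] g := (hE n).const_mul c
  have hf_int : Integrable f P := hE_mul n (((integrable_const 1).add
    ((hRint n).const_mul c)).add (((hSint n).add (hYint n)).const_mul (c * α)))
  have hg_bound : ∀ᵐ ω ∂P, ‖g ω‖ ≤ c * Real.exp (c * (n * M + M + 2 * M)) := by
    filter_upwards [hE_bound n] with ω hω
    rw [hg_def, norm_mul, Real.norm_of_nonneg hc.le]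
    exact mul_le_mul_of_nonneg_left hω hc.le
  have hgX : Integrable (g * X (n + 1)) P :=
    (hXint (n + 1)).bdd_mul (hg.mono (𝓕.le n) le_rfl).aestronglyMeasurable hg_bound
  have hmono : P[fun ω => blockPotential M c α (X · ω) (Y · ω) (n + 1) | 𝓕 n] ≤ᵐ[P]
      P[f - g * X (n + 1) | 𝓕 n] := by
    refine condExp_mono (hV_int (n + 1)) (hf_int.sub hgX) ?_
    filter_upwards [hbd] with ω hω
    refine (blockPotential_succ_le hM hc hcM hcα (fun n => hYmem n ω) hω n).trans_eq ?_
    simp only [blockPotentialNext, hf_def, hg_def, hE_def, hR_def, hS_def, Pi.sub_apply,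
      Pi.mul_apply]
    ring
  have hcond := condExp_sub_mul_le (𝓕.le n) hf.stronglyMeasurable hg.stronglyMeasurable hf_int
    (hXint (n + 1)) (fun ω => by positivity) hg_bound (hsub n)
  filter_upwards [hmono, hcond] with ω h1 h2
  refine (h1.trans h2).trans_eq ?_
  simp only [blockPotential, hf_def, hg_def, hE_def, hR_def, hS_def, Pi.sub_apply, Pi.mul_apply]
  ring

lemma ae_bddAbove_of_supermartingale_nonneg [IsFiniteMeasure P] {V : ℕ → Ω → ℝ}
    (hV : Supermartingale V 𝓕 P) (h0 : ∀ n, 0 ≤ᵐ[P] V n) :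
    ∀ᵐ ω ∂P, BddAbove (Set.range fun n => V n ω) := by
  have hbound n : eLpNorm ((-V) n) 1 P ≤ (∫ ω, V 0 ω ∂P).toNNReal := by
    rw [Pi.neg_apply, eLpNorm_neg, eLpNorm_one_eq_lintegral_enorm,
      ← ofReal_integral_norm_eq_lintegral_enorm (hV.integrable n)]
    refine ENNReal.ofReal_le_ofReal ?_
    have h1 : ∫ ω, ‖V n ω‖ ∂P = ∫ ω, V n ω ∂P :=
      integral_congr_ae ((h0 n).mono fun ω hω => Real.norm_of_nonneg hω)
    have h2 := hV.setIntegral_le n.zero_le MeasurableSet.univ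
    rw [setIntegral_univ, setIntegral_univ] at h2
    exact h1.trans_le h2
  filter_upwards [hV.neg.exists_ae_tendsto_of_bdd hbound] with ω ⟨a, ha⟩
  simpa using ha.neg.bddAbove_range

lemma ae_bddBelow_range [IsFiniteMeasure P] (hM : 0 < M) (hα : 0 < α) (hX : Adapted 𝓕 X)
    (hY : Adapted 𝓕 Y) (hYmem : ∀ n ω, Y n ω ∈ Set.Icc (0:ℝ) M) (hX0 : Integrable (X 0) P)
    (hbd : ∀ᵐ ω ∂P, ∀ n m, n ≤ m →
      |X n ω - X m ω| ≤ (∑ l ∈ Finset.Ico n m, Y l ω) + M)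
    (hsub : ∀ n, ∀ᵐ ω ∂P, X n ω + α * Y n ω ≤ (P[X (n+1) | 𝓕 n]) ω) :
    ∀ᵐ ω ∂P, BddBelow (Set.range fun n => X n ω) := by
  obtain ⟨c, hc, hcM, hcα⟩ : ∃ c : ℝ, 0 < c ∧ c * (6 * M) ≤ 1 ∧ c * (9 * M) ≤ α := by
    refine ⟨min (1 / (6 * M)) (α / (9 * M)), by positivity, ?_, ?_⟩
    · exact (le_div_iff₀ (by positivity)).1 (min_le_left _ _)
    · exact (le_div_iff₀ (by positivity)).1 (min_le_right _ _)
  have hV := supermartingale_blockPotential hM hc hcM hcα hX hY hYmem hX0 hbd hsub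
  have hV0 n : 0 ≤ᵐ[P] fun ω => blockPotential M c α (X · ω) (Y · ω) n := by
    filter_upwards [hbd] with ω hω
    have h := exp_le_two_mul_blockPotential hM hα hc hcM (fun n => hYmem n ω) hω n
    have h' := (Real.exp_pos _).trans_le h
    simp only [Pi.zero_apply]
    linarith
  filter_upwards [ae_bddAbove_of_supermartingale_nonneg hV hV0, hbd] with ω ⟨K, hK⟩ hω
  exact bddBelow_of_blockPotential_le hM hα hc hcM (fun n => hYmem n ω) hω
    fun n => hK ⟨n, rfl⟩

lemma ae_summable_of_bddAbove_range [IsFiniteMeasure P] (hα : 0 < α)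
    (hX : Adapted 𝓕 X) (hY : Adapted 𝓕 Y) (hYmem : ∀ n ω, Y n ω ∈ Set.Icc (0:ℝ) M)
    (hX0 : Integrable (X 0) P)
    (hbd : ∀ᵐ ω ∂P, ∀ n m, n ≤ m →
      |X n ω - X m ω| ≤ (∑ l ∈ Finset.Ico n m, Y l ω) + M)
    (hsub : ∀ n, ∀ᵐ ω ∂P, X n ω + α * Y n ω ≤ (P[X (n+1) | 𝓕 n]) ω) :
    ∀ᵐ ω ∂P, BddAbove (Set.range fun n => X n ω) → Summable fun n => Y n ω := by
  have hXint := integrable_of_ae_bound hX hX0 hYmem hbd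
  have hYint n : Integrable (Y n) P := by
    refine Integrable.of_bound (C := M) ((hY n).mono (𝓕.le n) le_rfl).aestronglyMeasurable
      (ae_of_all _ fun ω => ?_)
    rw [Real.norm_eq_abs, abs_of_nonneg (hYmem n ω).1]
    exact (hYmem n ω).2
  set A : ℕ → Ω → ℝ := fun n ω => α * ∑ l ∈ Finset.range n, Y l ω with hA_def
  have hA {n k : ℕ} (hnk : n ≤ k + 1) : Measurable[𝓕 k] (A n) :=
    (Finset.measurable_fun_sum _ fun l hl => (hY l).mono
      (𝓕.mono (by have := Finset.mem_range.1 hl; omega)) le_rfl).const_mul α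
  have hAint n : Integrable (A n) P := (integrable_finsetSum _ fun l _ => hYint l).const_mul α
  have hN : Submartingale (X - A) 𝓕 P := by
    refine submartingale_nat
      (fun n => ((hX n).sub (hA n.le_succ)).stronglyMeasurable)
      (fun n => (hXint n).sub (hAint n)) fun n => ?_
    filter_upwards [condExp_sub (hXint (n + 1)) (hAint (n + 1)) (𝓕 n), hsub n] with ω h1 h2
    simp only [Pi.sub_apply]
    rw [h1, Pi.sub_apply, condExp_of_stronglyMeasurable (𝓕.le n)
      (hA le_rfl).stronglyMeasurable (hAint (n + 1))]
    simp only [hA_def, Finset.sum_range_succ]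
    linarith
  have hdiff : ∀ᵐ ω ∂P, ∀ n, |(X - A) (n + 1) ω - (X - A) n ω| ≤
      ((2 * M + α * M).toNNReal : ℝ) := by
    filter_upwards [hbd] with ω hω n
    refine le_trans ?_ (Real.le_coe_toNNReal _)
    have h1 := abs_le.1 (abs_succ_sub_le (fun n => hYmem n ω) hω n)
    have h2 := mul_le_mul_of_nonneg_left (hYmem n ω).2 hα.le
    have h3 := mul_nonneg hα.le (hYmem n ω).1
    simp only [Pi.sub_apply, hA_def, Finset.sum_range_succ]
    rw [abs_le]
    have hM : 0 ≤ M := (hYmem n ω).1.trans (hYmem n ω).2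
    constructor <;> nlinarith
  filter_upwards [hN.bddAbove_iff_exists_tendsto hdiff] with ω hω ⟨K, hK⟩
  have hA0 n : 0 ≤ A n ω := mul_nonneg hα.le (Finset.sum_nonneg fun l _ => (hYmem l ω).1)
  obtain ⟨a, ha⟩ := hω.1 ⟨K, by
    rintro _ ⟨n, rfl⟩
    exact (sub_le_self _ (hA0 n)).trans (hK ⟨n, rfl⟩)⟩
  obtain ⟨b, hb⟩ := ha.bddBelow_range
  refine summable_of_sum_range_le (c := (K - b) / α) (fun n => (hYmem n ω).1) fun n => ?_
  rw [le_div_iff₀' hα]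
  have h1 : b ≤ X n ω - A n ω := hb ⟨n, rfl⟩
  have h2 : X n ω ≤ K := hK ⟨n, rfl⟩
  have h3 : A n ω = α * ∑ l ∈ Finset.range n, Y l ω := rfl
  linarith

end Random

/-- Lemma 4.1 of the paper: if `(X_n)` and `(Y_n)` are adapted processes
with `Y_n` valued in `[0, M]`, `E[|X_0|] < ∞`, `|X_n − X_m| ≤ Σ_{l=n}^{m−1} Y_l + M` a.s.,
and `E[X_{n+1} | 𝓕_n] ≥ X_n + α·Y_n` a.s., then almost surely `inf_n X_n > −∞`, and on the
event `sup_n X_n < ∞` the series `Σ_n Y_n` converges. -/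
theorem statement8 {Ω : Type*} {m0 : MeasurableSpace Ω} (P : Measure Ω)
    [IsProbabilityMeasure P] (𝓕 : Filtration ℕ m0) (α M : ℝ) (hα : 0 < α) (hM : 0 < M)
    (X Y : ℕ → Ω → ℝ) (hX : Adapted 𝓕 X) (hY : Adapted 𝓕 Y)
    (hYmem : ∀ n ω, Y n ω ∈ Set.Icc (0:ℝ) M)
    (hX0 : Integrable (X 0) P)
    (hbd : ∀ n m : ℕ, n ≤ m → ∀ᵐ ω ∂P, |X n ω - X m ω| ≤ (∑ l ∈ Finset.Ico n m, Y l ω) + M)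
    (hsub : ∀ n, ∀ᵐ ω ∂P, X n ω + α * Y n ω ≤ (P[X (n+1) | 𝓕 n]) ω) :
    ∀ᵐ ω ∂P, BddBelow (Set.range fun n => X n ω) ∧
      (BddAbove (Set.range fun n => X n ω) → Summable fun n => Y n ω) := by
  have hbd' : ∀ᵐ ω ∂P, ∀ n m, n ≤ m →
      |X n ω - X m ω| ≤ (∑ l ∈ Finset.Ico n m, Y l ω) + M := by
    simpa only [ae_all_iff] using hbd
  filter_upwards [ae_bddBelow_range hM hα hX hY hYmem hX0 hbd' hsub,
    ae_summable_of_bddAbove_range hα hX hY hYmem hX0 hbd' hsub] with ω h1 h2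
  exact ⟨h1, h2⟩
end

section
/- Let Ω be a probability space, (𝓕_n) a filtration, α, M > 0, (X'_n) and (Y_n) stochastic processes adapted to (𝓕_n) with Y_n taking values in [0,M], and (X_n) an arbitrary (measurable, not necessarily adapted) real-valued stochastic process. Assume: (i) |X_n − X'_n| ≤ M almost surely for all n; (ii) E[|X_0|] < ∞; (iii) |X_{n+1} − X_n| ≤ Y_n almost surely; (iv) E[X_{n+1} − X_n | 𝓕_n] ≥ α·Y_n almost surely. Then for almost every ω: inf_n X_n(ω) > −∞, and if sup_n X_n(ω) < +∞ then Σ_n Y_n(ω) < +∞. -/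
open MeasureTheory

section Helpers

open Filter Topology

/-- If `|u| ≤ log (1 + α)`, then `exp v - exp u` is at least `(v - u) - α * |v - u|`. -/
lemma sub_sub_mul_abs_le_exp_sub_exp {α u v : ℝ} (hα : 0 < α) (hu : |u| ≤ Real.log (1 + α)) :
    v - u - α * |v - u| ≤ Real.exp v - Real.exp u := by
  obtain ⟨hl, hr⟩ := abs_le.1 hu
  have hexp : |1 - Real.exp u| ≤ α := by
    rw [abs_le]
    have h₁ : Real.exp u ≤ 1 + α := by
      simpa [Real.exp_log (by linarith : 0 < 1 + α)] using Real.exp_le_exp.2 hr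
    have h₂ : Real.exp (-u) ≤ 1 + α := by
      simpa [Real.exp_log (by linarith : 0 < 1 + α)] using
        Real.exp_le_exp.2 (neg_le.1 hl)
    have h₃ : Real.exp u * Real.exp (-u) = 1 := by rw [← Real.exp_add]; simp
    have h₄ := Real.exp_pos u
    constructor <;> nlinarith
  have htangent : (v - u) * Real.exp u ≤ Real.exp v - Real.exp u := by
    have h₁ := Real.add_one_le_exp (v - u)
    have h₂ : Real.exp v = Real.exp (v - u) * Real.exp u := by rw [← Real.exp_add]; simp
    have h₃ := Real.exp_pos u
    nlinarith
  have hprod : (v - u) * (1 - Real.exp u) ≤ α * |v - u| := by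
    calc (v - u) * (1 - Real.exp u) ≤ |(v - u) * (1 - Real.exp u)| := le_abs_self _
      _ = |1 - Real.exp u| * |v - u| := by rw [abs_mul, mul_comm]
      _ ≤ α * |v - u| := by gcongr
  linarith

variable {Ω : Type*} {m0 : MeasurableSpace Ω} {P : Measure Ω} {𝓕 : Filtration ℕ m0}

/-- A random variable within `c` of an `m`-measurable one has its conditional expectation given `m`
within `c` of it as well. -/
lemma abs_condExp_sub_le_of_abs_sub_le [IsFiniteMeasure P] {m : MeasurableSpace Ω} (hm : m ≤ m0)
    {U V : Ω → ℝ} {c : ℝ} (hU : Integrable U P) (hV : StronglyMeasurable[m] V)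
    (h : ∀ᵐ ω ∂P, |U ω - V ω| ≤ c) : ∀ᵐ ω ∂P, |(P[U | m]) ω - V ω| ≤ c := by
  have hUV : Integrable (U - V) P :=
    Integrable.of_bound (hU.1.sub (hV.mono hm).aestronglyMeasurable) c h
  have hVi : Integrable V P := by simpa using hU.sub hUV
  have hconst : P[fun _ : Ω => c | m] = fun _ => c := condExp_const hm c
  have hconst' : P[fun _ : Ω => -c | m] = fun _ => -c := condExp_const hm (-c)
  have hup := condExp_mono (m := m) hUV (integrable_const c)
    (h.mono fun ω hω => (abs_le.1 hω).2)
  have hlow := condExp_mono (m := m) (integrable_const (-c)) hUV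
    (h.mono fun ω hω => (abs_le.1 hω).1)
  filter_upwards [hup, hlow, condExp_sub hU hVi m] with ω h₁ h₂ h₃
  rw [condExp_of_stronglyMeasurable hm hV hVi] at h₃
  rw [hconst] at h₁
  rw [hconst'] at h₂
  rw [h₃, Pi.sub_apply] at h₁ h₂
  exact abs_le.2 ⟨h₂, h₁⟩

/-- If the increments of a not necessarily adapted process `G` have conditional drift at least `H`,
then the adapted projection of `G` compensated by the partial sums of `H` is a submartingale. -/
lemma submartingale_condExp_sub_sum [IsFiniteMeasure P] {G H : ℕ → Ω → ℝ}
    (hG : ∀ n, Integrable (G n) P) (hH : ∀ n, Integrable (H n) P) (hHa : StronglyAdapted 𝓕 H)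
    (h : ∀ n, H n ≤ᵐ[P] P[G (n + 1) - G n | 𝓕 n]) :
    Submartingale (fun n => P[G n | 𝓕 n] - ∑ i ∈ Finset.range n, H i) 𝓕 P := by
  refine submartingale_of_condExp_sub_nonneg_nat (fun n => ?_) (fun n => ?_) fun n => ?_
  · refine stronglyMeasurable_condExp.sub (Finset.stronglyMeasurable_sum _ fun i hi => ?_)
    exact (hHa i).mono (𝓕.mono (Finset.mem_range.1 hi).le)
  · exact integrable_condExp.sub (integrable_finsetSum' _ fun i _ => hH i)
  · have heq : (P[G (n + 1) | 𝓕 (n + 1)] - ∑ i ∈ Finset.range (n + 1), H i)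
        - (P[G n | 𝓕 n] - ∑ i ∈ Finset.range n, H i)
        = P[G (n + 1) | 𝓕 (n + 1)] - (P[G n | 𝓕 n] + H n) := by
      rw [Finset.sum_range_succ]; abel
    rw [heq]
    filter_upwards [h n, condExp_sub (hG (n + 1)) (hG n) (𝓕 n),
      condExp_sub (m := 𝓕 n) (integrable_condExp (m := 𝓕 (n + 1)) (f := G (n + 1)))
        ((integrable_condExp (m := 𝓕 n) (f := G n)).add (hH n)),
      condExp_condExp_of_le (f := G (n + 1)) (μ := P) (𝓕.mono n.le_succ) (𝓕.le (n + 1))]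
      with ω h₁ h₂ h₃ h₄
    rw [condExp_of_stronglyMeasurable (𝓕.le n) (stronglyMeasurable_condExp.add (hHa n))
      (integrable_condExp.add (hH n))] at h₃
    simp only [Pi.sub_apply, Pi.add_apply, Pi.zero_apply] at *
    rw [h₃, h₄]
    linarith

/-- A nonnegative supermartingale is almost surely bounded above. -/
lemma MeasureTheory.Supermartingale.ae_bddAbove_of_nonneg [IsFiniteMeasure P] {f : ℕ → Ω → ℝ}
    (hf : Supermartingale f 𝓕 P) (hnonneg : ∀ n, 0 ≤ᵐ[P] f n) :
    ∀ᵐ ω ∂P, BddAbove (Set.range fun n => f n ω) := by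
  have hbdd : ∀ n, eLpNorm ((-f) n) 1 P ≤ (∫ ω, f 0 ω ∂P).toNNReal := fun n => by
    rw [Pi.neg_apply, eLpNorm_neg, eLpNorm_one_eq_lintegral_enorm,
      ← ofReal_integral_norm_eq_lintegral_enorm (hf.integrable n)]
    refine ENNReal.ofReal_le_ofReal ?_
    have hle := hf.setIntegral_le (Nat.zero_le n) MeasurableSet.univ
    simp only [setIntegral_univ] at hle
    refine (integral_congr_ae ?_).trans_le hle
    filter_upwards [hnonneg n] with ω hω
    exact Real.norm_of_nonneg hω
  filter_upwards [hf.neg.exists_ae_tendsto_of_bdd hbdd] with ω ⟨c, hc⟩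
  simpa using hc.neg.bddAbove_range

/-- A process close to an adapted one, whose increments are bounded by `Y` and have conditional
drift at least `α * Y`, is almost surely bounded below. -/
lemma ae_bddBelow_of_le_condExp_sub [IsFiniteMeasure P] {α M : ℝ} (hα : 0 < α) (hM : 0 < M)
    {U V Y : ℕ → Ω → ℝ} {B : ℕ → ℝ} (hV : StronglyAdapted 𝓕 V) (hY : StronglyAdapted 𝓕 Y)
    (hU : ∀ n, Measurable (U n)) (hYmem : ∀ n ω, Y n ω ∈ Set.Icc 0 M)
    (hUV : ∀ n, ∀ᵐ ω ∂P, |U n ω - V n ω| ≤ M) (hB : ∀ n, ∀ᵐ ω ∂P, |U n ω| ≤ B n)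
    (hinc : ∀ n, ∀ᵐ ω ∂P, |U (n + 1) ω - U n ω| ≤ Y n ω)
    (hdrift : ∀ n, ∀ᵐ ω ∂P, α * Y n ω ≤ (P[U (n + 1) - U n | 𝓕 n]) ω) :
    ∀ᵐ ω ∂P, BddBelow (Set.range fun n => U n ω) := by
  obtain ⟨l, hl, hlM⟩ : ∃ l : ℝ, 0 < l ∧ l * (2 * M) = Real.log (1 + α) :=
    ⟨Real.log (1 + α) / (2 * M), div_pos (Real.log_pos (by linarith)) (by linarith),
      by field_simp⟩
  have hVmeas : ∀ n, Measurable (V n) := fun n => ((hV n).mono (𝓕.le n)).measurable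
  have hYmeas : ∀ n, Measurable (Y n) := fun n => ((hY n).mono (𝓕.le n)).measurable
  have hVB : ∀ n, ∀ᵐ ω ∂P, |V n ω| ≤ B n + M := fun n => by
    filter_upwards [hUV n, hB n] with ω h₁ h₂
    rw [abs_le] at *
    constructor <;> linarith
  have hexp_int : ∀ {W : Ω → ℝ} {b : ℝ}, Measurable W → (∀ᵐ ω ∂P, |W ω| ≤ b) →
      Integrable (fun ω => Real.exp (-(l * W ω))) P := fun {W b} hW hb => by
    refine Integrable.of_bound (by fun_prop) (Real.exp (l * b)) (hb.mono fun ω hω => ?_)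
    rw [Real.norm_of_nonneg (Real.exp_pos _).le, Real.exp_le_exp, ← mul_neg]
    exact mul_le_mul_of_nonneg_left ((neg_le_abs _).trans hω) hl.le
  set G : ℕ → Ω → ℝ := fun n ω => Real.exp (-(l * U n ω)) with hGdef
  have hGint : ∀ n, Integrable (G n) P := fun n => hexp_int (hU n) (hB n)
  have hdriftG : ∀ n, (0 : Ω → ℝ) ≤ᵐ[P] P[(-G) (n + 1) - (-G) n | 𝓕 n] := fun n => by
    set E : Ω → ℝ := fun ω => l * Real.exp (-(l * V n ω)) with hEdef
    set D : Ω → ℝ := (U (n + 1) - U n) - fun ω => α * Y n ω with hDdef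
    have hUd : Integrable (U (n + 1) - U n) P := by
      refine Integrable.of_bound ((hU (n + 1)).sub (hU n)).aestronglyMeasurable M ?_
      exact (hinc n).mono fun ω hω => hω.trans (hYmem n ω).2
    have hαY : Integrable (fun ω => α * Y n ω) P := by
      refine (Integrable.of_bound (hYmeas n).aestronglyMeasurable M (ae_of_all _ fun ω => ?_)
        ).const_mul α
      rw [Real.norm_of_nonneg (hYmem n ω).1]
      exact (hYmem n ω).2
    have hDint : Integrable D P := hUd.sub hαY
    have hEm : StronglyMeasurable[𝓕 n] E := by
      have := (hV n).measurable
      exact Measurable.stronglyMeasurable (by fun_prop)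
    have hEint : Integrable E P := (hexp_int (hVmeas n) (hVB n)).const_mul l
    have hEDint : Integrable (E * D) P := by
      refine hEint.mul_bdd (c := M + α * M) hDint.1 ?_
      filter_upwards [hinc n] with ω hω
      have h₁ := hYmem n ω
      have h₂ : α * Y n ω ≤ α * M := by gcongr; exact h₁.2
      have h₃ : 0 ≤ α * Y n ω := mul_nonneg hα.le h₁.1
      have h₄ := h₁.2
      rw [abs_le] at hω
      rw [Real.norm_eq_abs, abs_le]
      simp only [hDdef, Pi.sub_apply]
      constructor <;> linarith
    have hle : E * D ≤ᵐ[P] (-G) (n + 1) - (-G) n := by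
      filter_upwards [hinc n, hUV n] with ω h₁ h₂
      have hu : |-(l * (U (n + 1) ω - V n ω))| ≤ Real.log (1 + α) := by
        rw [abs_neg, abs_mul, abs_of_pos hl, ← hlM]
        refine mul_le_mul_of_nonneg_left ?_ hl.le
        have h₃ := (hYmem n ω).2
        rw [abs_le] at *
        constructor <;> linarith
      have key := sub_sub_mul_abs_le_exp_sub_exp (v := -(l * (U n ω - V n ω))) hα hu
      have hdiff : -(l * (U n ω - V n ω)) - -(l * (U (n + 1) ω - V n ω))
          = l * (U (n + 1) ω - U n ω) := by ring
      rw [hdiff, abs_mul, abs_of_pos hl] at key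
      have h₅ : l * (U (n + 1) ω - U n ω - α * Y n ω) ≤
          Real.exp (-(l * (U n ω - V n ω))) - Real.exp (-(l * (U (n + 1) ω - V n ω))) := by
        have h₆ := mul_le_mul_of_nonneg_left h₁ (mul_pos hα hl).le
        linarith
      have h₇ := mul_le_mul_of_nonneg_left h₅ (Real.exp_pos (-(l * V n ω))).le
      have hexp_mul : ∀ x, Real.exp (-(l * V n ω)) * Real.exp (-(l * (x - V n ω)))
          = Real.exp (-(l * x)) := fun x => by
        rw [← Real.exp_add]
        ring_nf
      rw [mul_sub (Real.exp _) (Real.exp _), hexp_mul, hexp_mul] at h₇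
      simp only [hEdef, hDdef, hGdef, Pi.mul_apply, Pi.sub_apply, Pi.neg_apply]
      linarith
    filter_upwards [condExp_mono (m := 𝓕 n) hEDint ((hGint (n + 1)).neg.sub (hGint n).neg) hle,
      condExp_mul_of_stronglyMeasurable_left hEm hEDint hDint, condExp_sub hUd hαY (𝓕 n),
      hdrift n] with ω h₁ h₂ h₃ h₄
    rw [condExp_of_stronglyMeasurable (𝓕.le n) ((hY n).const_mul α) hαY] at h₃
    refine le_trans ?_ h₁
    rw [h₂, Pi.mul_apply, h₃, Pi.sub_apply]
    exact mul_nonneg (mul_nonneg hl.le (Real.exp_pos _).le) (sub_nonneg.2 h₄)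
  have hsub := submartingale_condExp_sub_sum (fun n => (hGint n).neg)
    (fun _ => integrable_zero Ω ℝ P) (fun _ => stronglyMeasurable_zero) hdriftG
  have hGnonneg : ∀ n, 0 ≤ᵐ[P] P[G n | 𝓕 n] := fun n =>
    condExp_nonneg (ae_of_all _ fun ω => (Real.exp_pos _).le)
  have hneg : ∀ n, (-fun n => P[-G n | 𝓕 n] - ∑ _i ∈ Finset.range n, (0 : Ω → ℝ)) n
      =ᵐ[P] P[G n | 𝓕 n] := fun n => by
    filter_upwards [condExp_neg (μ := P) (G n) (𝓕 n)] with ω hω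
    simp [hω]
  have hbdd := hsub.neg.ae_bddAbove_of_nonneg fun n => by
    filter_upwards [hneg n, hGnonneg n] with ω h₁ h₂
    rw [h₁]
    exact h₂
  have hlower : ∀ n, (fun ω => Real.exp (-(l * (V n ω + M)))) ≤ᵐ[P] P[G n | 𝓕 n] := fun n => by
    have hexpV_int : Integrable (fun ω => Real.exp (-(l * (V n ω + M)))) P := by
      refine hexp_int (W := fun ω => V n ω + M) (b := B n + M + M) ((hVmeas n).add_const M) ?_
      filter_upwards [hVB n] with ω hω
      rw [abs_le] at *
      constructor <;> linarith
    have hmeas : StronglyMeasurable[𝓕 n] (fun ω => Real.exp (-(l * (V n ω + M)))) := by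
      have := (hV n).measurable
      exact Measurable.stronglyMeasurable (by fun_prop)
    rw [← condExp_of_stronglyMeasurable (𝓕.le n) hmeas hexpV_int]
    refine condExp_mono hexpV_int (hGint n) ?_
    filter_upwards [hUV n] with ω hω
    have := (abs_le.1 hω).2
    exact Real.exp_le_exp.2 (neg_le_neg (mul_le_mul_of_nonneg_left (by linarith) hl.le))
  filter_upwards [hbdd, ae_all_iff.2 hneg, ae_all_iff.2 hlower, ae_all_iff.2 hUV]
    with ω ⟨w, hw⟩ h₁ h₂ h₃
  refine ⟨(1 - w) / l - 2 * M, ?_⟩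
  rintro _ ⟨n, rfl⟩
  have hwn := hw (Set.mem_range_self n)
  simp only [h₁ n] at hwn
  have hexp := (h₂ n).trans hwn
  have h₄ := (Real.add_one_le_exp _).trans hexp
  have h₅ := (abs_le.1 (h₃ n)).1
  have h₆ : (1 - w) / l ≤ V n ω + M := by
    rw [div_le_iff₀ hl]
    linarith
  linarith

/-- On the event that it is bounded above, a process close to an adapted one, with bounded
increments and conditional drift at least `Y`, has summable `Y`. -/
lemma ae_summable_of_le_condExp_sub [IsFiniteMeasure P] {M K : ℝ}
    {U V Y : ℕ → Ω → ℝ} (hV : StronglyAdapted 𝓕 V) (hY : StronglyAdapted 𝓕 Y)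
    (hU : ∀ n, Integrable (U n) P) (hYmem : ∀ n ω, Y n ω ∈ Set.Icc 0 K)
    (hUV : ∀ n, ∀ᵐ ω ∂P, |U n ω - V n ω| ≤ M)
    (hinc : ∀ n, ∀ᵐ ω ∂P, |U (n + 1) ω - U n ω| ≤ M)
    (hdrift : ∀ n, Y n ≤ᵐ[P] P[U (n + 1) - U n | 𝓕 n]) :
    ∀ᵐ ω ∂P, BddAbove (Set.range fun n => U n ω) → Summable fun n => Y n ω := by
  have hYint : ∀ n, Integrable (Y n) P := fun n => by
    refine Integrable.of_bound ((hY n).mono (𝓕.le n)).aestronglyMeasurable K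
      (ae_of_all _ fun ω => ?_)
    rw [Real.norm_of_nonneg (hYmem n ω).1]
    exact (hYmem n ω).2
  have hsub := submartingale_condExp_sub_sum hU hYint hY hdrift
  have hclose : ∀ n, ∀ᵐ ω ∂P, |(P[U n | 𝓕 n]) ω - V n ω| ≤ M := fun n =>
    abs_condExp_sub_le_of_abs_sub_le (𝓕.le n) (hU n) (hV n) (hUV n)
  have hbdd := hsub.bddAbove_iff_exists_tendsto (R := (5 * M + K).toNNReal) <| by
    filter_upwards [ae_all_iff.2 hclose, ae_all_iff.2 hUV, ae_all_iff.2 hinc] with ω h₁ h₂ h₃ n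
    refine le_trans ?_ (Real.le_coe_toNNReal _)
    have a₁ := abs_le.1 (h₁ n)
    have a₂ := abs_le.1 (h₁ (n + 1))
    have a₃ := abs_le.1 (h₂ n)
    have a₄ := abs_le.1 (h₂ (n + 1))
    have a₅ := abs_le.1 (h₃ n)
    have a₆ := hYmem n ω
    simp only [Pi.sub_apply, Finset.sum_apply, Finset.sum_range_succ, Pi.add_apply]
    rw [abs_le]
    constructor <;> linarith [a₆.1, a₆.2]
  filter_upwards [ae_all_iff.2 hclose, ae_all_iff.2 hUV, hbdd] with ω h₁ h₂ h₃ ⟨b, hb⟩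
  have hZ : ∀ n, (P[U n | 𝓕 n]) ω ≤ b + 2 * M := fun n => by
    have a₁ := abs_le.1 (h₁ n)
    have a₂ := abs_le.1 (h₂ n)
    have a₃ := hb (Set.mem_range_self n)
    linarith
  obtain ⟨c, hc⟩ := h₃.1 <| by
    refine ⟨b + 2 * M, ?_⟩
    rintro _ ⟨n, rfl⟩
    have hs : 0 ≤ ∑ i ∈ Finset.range n, Y i ω := Finset.sum_nonneg fun i _ => (hYmem i ω).1
    simp only [Pi.sub_apply, Finset.sum_apply]
    linarith [hZ n]
  obtain ⟨a, ha⟩ := hc.bddBelow_range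
  refine summable_of_sum_range_le (c := b + 2 * M - a) (fun n => (hYmem n ω).1) fun n => ?_
  have han := ha (Set.mem_range_self n)
  simp only [Pi.sub_apply, Finset.sum_apply] at han
  linarith [hZ n]

end Helpers

/-- Corollary 4.2 of the paper: if `(X'_n)`, `(Y_n)` are adapted,
`(X_n)` is an arbitrary (measurable) process with `|X_n − X'_n| ≤ M`,
`E[|X_0|] < ∞`, `|X_{n+1} − X_n| ≤ Y_n` a.s. and `E[X_{n+1} − X_n | 𝓕_n] ≥ α·Y_n` a.s.,
then almost surely `inf_n X_n > −∞`, and on the event `sup_n X_n < ∞` the series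
`Σ_n Y_n` converges. -/
theorem statement9 {Ω : Type*} {m0 : MeasurableSpace Ω} (P : Measure Ω)
    [IsProbabilityMeasure P] (𝓕 : Filtration ℕ m0) (α M : ℝ) (hα : 0 < α) (hM : 0 < M)
    (X' Y X : ℕ → Ω → ℝ) (hX' : Adapted 𝓕 X') (hY : Adapted 𝓕 Y)
    (hX : ∀ n, Measurable (X n))
    (hYmem : ∀ n ω, Y n ω ∈ Set.Icc (0:ℝ) M)
    (h1 : ∀ n, ∀ᵐ ω ∂P, |X n ω - X' n ω| ≤ M)
    (h2 : Integrable (X 0) P)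
    (h3 : ∀ n, ∀ᵐ ω ∂P, |X (n+1) ω - X n ω| ≤ Y n ω)
    (h4 : ∀ n, ∀ᵐ ω ∂P, α * Y n ω ≤ (P[fun ω' => X (n+1) ω' - X n ω' | 𝓕 n]) ω) :
    ∀ᵐ ω ∂P, BddBelow (Set.range fun n => X n ω) ∧
      (BddAbove (Set.range fun n => X n ω) → Summable fun n => Y n ω) := by
  set U : ℕ → Ω → ℝ := fun n ω => X n ω - X' 0 ω with hUdef
  have hX'0 : Measurable (X' 0) := (hX' 0).mono (𝓕.le 0) le_rfl
  have hUmeas : ∀ n, Measurable (U n) := fun n => (hX n).sub hX'0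
  have hV : StronglyAdapted 𝓕 fun n ω => X' n ω - X' 0 ω := fun n =>
    ((hX' n).sub ((hX' 0).mono (𝓕.mono n.zero_le) le_rfl)).stronglyMeasurable
  have hYs : StronglyAdapted 𝓕 Y := fun n => (hY n).stronglyMeasurable
  have hUV : ∀ n, ∀ᵐ ω ∂P, |U n ω - (X' n ω - X' 0 ω)| ≤ M := fun n => by
    simpa [hUdef] using h1 n
  have hinc : ∀ n, ∀ᵐ ω ∂P, |U (n + 1) ω - U n ω| ≤ Y n ω := fun n => by
    simpa [hUdef] using h3 n
  have hdrift : ∀ n, ∀ᵐ ω ∂P, α * Y n ω ≤ (P[U (n + 1) - U n | 𝓕 n]) ω := fun n => by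
    have heq : U (n + 1) - U n = fun ω => X (n + 1) ω - X n ω := by
      ext ω
      simp [hUdef]
    rw [heq]
    exact h4 n
  have hB : ∀ n : ℕ, ∀ᵐ ω ∂P, |U n ω| ≤ (n + 1) * M := fun n => by
    induction n with
    | zero => simpa [hUdef] using h1 0
    | succ n ih =>
      filter_upwards [ih, hinc n] with ω ih h
      have hYM := (hYmem n ω).2
      push_cast
      rw [abs_le] at *
      constructor <;> linarith
  have hbelow := ae_bddBelow_of_le_condExp_sub hα hM hV hYs hUmeas hYmem hUV hB hinc hdrift
  have hsum := ae_summable_of_le_condExp_sub (K := α * M) hV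
    (fun n => (hYs n).const_mul α)
    (fun n => Integrable.of_bound (hUmeas n).aestronglyMeasurable _ (hB n))
    (fun n ω => ⟨mul_nonneg hα.le (hYmem n ω).1, mul_le_mul_of_nonneg_left (hYmem n ω).2 hα.le⟩)
    hUV (fun n => (hinc n).mono fun ω hω => hω.trans (hYmem n ω).2) hdrift
  filter_upwards [hbelow, hsum] with ω ⟨b, hb⟩ hs
  refine ⟨⟨b + X' 0 ω, ?_⟩, fun ⟨c, hc⟩ => (summable_mul_left_iff hα.ne').1 (hs ⟨c - X' 0 ω, ?_⟩)⟩
  · rintro _ ⟨n, rfl⟩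
    exact le_sub_iff_add_le.1 (hb (Set.mem_range_self n))
  · rintro _ ⟨n, rfl⟩
    exact sub_le_sub_right (hc (Set.mem_range_self n)) _
end

section
/- Let S be a gambling strategy, F a forecaster, and x ∈ O^ω. Assume Σ_{n=0}^∞ (max over x_{:n}O^ω of (PG S)^F_n(x_{:n})(F_n(x_{:n}),·) − min over x_{:n}O^ω of (PG S)^F_n(x_{:n})(F_n(x_{:n}),·)) < +∞. Then for all sufficiently large n, (PG S)^F_n(x_{:n}) = S_n(x_{:n}). -/
open MeasureTheory Filter Set Topology
open scoped NNReal ENNReal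

noncomputable section

variable (O : ℕ → Type*) [∀ n, TopologicalSpace (O n)] [∀ n, CompactSpace (O n)]
  [∀ n, PolishSpace (O n)] [∀ n, MeasurableSpace (O n)] [∀ n, BorelSpace (O n)]

theorem exists_cyl_subset_of_mem_nhds {X : ℕ → Type*} [∀ n, TopologicalSpace (X n)]
    {x : Hw X} {U : Set (Hw X)} (hU : U ∈ 𝓝 x) :
    ∃ N, cyl X N (proj X N x) ⊆ U := by
  rw [nhds_pi, Filter.mem_pi] at hU
  obtain ⟨I, hI, t, ht, hsub⟩ := hU
  obtain ⟨N, hN⟩ := hI.bddAbove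
  refine ⟨N + 1, fun a ha => hsub fun i hi => ?_⟩
  have hai : a i = x i := congrFun ha ⟨i, Nat.lt_succ_of_le (hN hi)⟩
  rw [hai]
  exact mem_of_mem_nhds (ht i)

theorem cyl_proj_antitone_s11 {X : ℕ → Type*} (x : Hw X) {m n : ℕ} (hmn : m ≤ n) :
    cyl X n (proj X n x) ⊆ cyl X m (proj X m x) := fun _ ha =>
  funext fun i => congrFun ha (i.castLE hmn)

/-- If the spreads of continuous functions `g m` over the cylinders around `x` are summable,
then the spread of `∑ m < n, g m` over the cylinder of length `n - 1` is eventually at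
most `1`. -/
theorem eventually_sum_sub_le_one {X : ℕ → Type*} [∀ n, TopologicalSpace (X n)]
    [∀ n, CompactSpace (X n)] {g : ℕ → Hw X → ℝ} (hg : ∀ m, Continuous (g m)) (x : Hw X)
    (h : Summable fun n => sSup (g n '' cyl X n (proj X n x)) -
      sInf (g n '' cyl X n (proj X n x))) :
    ∀ᶠ n in atTop, ∀ a ∈ cyl X (n - 1) (proj X (n - 1) x),
      ∀ b ∈ cyl X (n - 1) (proj X (n - 1) x),
        ∑ m ∈ Finset.range n, (g m a - g m b) ≤ 1 := by
  set s : ℕ → ℝ := fun n => sSup (g n '' cyl X n (proj X n x)) -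
    sInf (g n '' cyl X n (proj X n x))
  have hle : ∀ m, ∀ a ∈ cyl X m (proj X m x), ∀ b ∈ cyl X m (proj X m x),
      g m a - g m b ≤ s m := fun m a ha b hb =>
    sub_le_sub
      (le_csSup ((isCompact_range (hg m)).bddAbove.mono (image_subset_range _ _))
        (mem_image_of_mem _ ha))
      (csInf_le ((isCompact_range (hg m)).bddBelow.mono (image_subset_range _ _))
        (mem_image_of_mem _ hb))
  obtain ⟨K, hK⟩ := summable_iff_vanishing_norm.1 h (1 / 2) (by norm_num)
  obtain ⟨k, hk⟩ := K.exists_nat_subset_range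
  have hf : Continuous fun a => ∑ m ∈ Finset.range k, g m a :=
    continuous_finsetSum _ fun m _ => hg m
  obtain ⟨N, hN⟩ := exists_cyl_subset_of_mem_nhds
    (hf.continuousAt.preimage_mem_nhds (Metric.ball_mem_nhds (x := _) (ε := 1 / 4) (by norm_num)))
  filter_upwards [eventually_ge_atTop (max k (N + 1))] with n hn a ha b hb
  have hkn : k ≤ n := le_of_max_le_left hn
  have hNn : N ≤ n - 1 := by have := le_of_max_le_right hn; omega
  have hfa := hN (cyl_proj_antitone_s11 x hNn ha)
  have hfb := hN (cyl_proj_antitone_s11 x hNn hb)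
  rw [mem_preimage, Metric.mem_ball, Real.dist_eq, abs_lt] at hfa hfb
  have htail : ∑ m ∈ Finset.Ico k n, (g m a - g m b) ≤ ∑ m ∈ Finset.Ico k n, s m :=
    Finset.sum_le_sum fun m hm => by
      have hm' : m ≤ n - 1 := by have := (Finset.mem_Ico.1 hm).2; omega
      exact hle m a (cyl_proj_antitone_s11 x hm' ha) b (cyl_proj_antitone_s11 x hm' hb)
  have hsmall := hK (Finset.Ico k n) <| Finset.disjoint_left.2 fun m hm hmK =>
    absurd (Finset.mem_range.1 (hk hmK)) (not_lt.2 (Finset.mem_Ico.1 hm).1)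
  rw [Real.norm_eq_abs, abs_lt] at hsmall
  rw [← Finset.sum_range_add_sum_Ico _ hkn, Finset.sum_sub_distrib]
  linarith [hfa.2, hfb.1, hsmall.2]

theorem csSup_sub_csInf_image_le {α : Type*} {t : Set α} (ht : t.Nonempty) {f : α → ℝ} {c : ℝ}
    (hf : ∀ a ∈ t, ∀ b ∈ t, f a - f b ≤ c) : sSup (f '' t) - sInf (f '' t) ≤ c := by
  rw [sub_le_iff_le_add]
  refine csSup_le (ht.image f) ?_
  rintro _ ⟨a, ha, rfl⟩
  rw [← sub_le_iff_le_add']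
  refine le_csInf (ht.image f) ?_
  rintro _ ⟨b, hb, rfl⟩
  linarith [hf a ha b hb]

/-- Proposition 4.2 of the paper: if the total spread of the bets of
`PG S` against a forecaster `F` along `x` is finite, then from some point on `PG S`
plays the strategy `S` in every round. -/
theorem statement11 (S : Strategy O) (F : Forecaster O) (x : Hw O)
    (h : Summable fun n =>
      sSup ((fun x' => PGfun O S n (proj O n x, fhist O F.F n (proj O n x))
          (F.F n (proj O n x), x')) '' cyl O n (proj O n x)) -
      sInf ((fun x' => PGfun O S n (proj O n x, fhist O F.F n (proj O n x))
          (F.F n (proj O n x), x')) '' cyl O n (proj O n x))) :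
    ∀ᶠ n in Filter.atTop,
      PGfun O S n (proj O n x, fhist O F.F n (proj O n x)) = S.S n (proj O n x) := by
  have hev := eventually_sum_sub_le_one
    (g := fun n x' => PGfun O S n (proj O n x, fhist O F.F n (proj O n x))
      (F.F n (proj O n x), x')) (fun m => by fun_prop) x h
  filter_upwards [hev] with n hn
  rw [PGfun]
  rw [if_pos]
  have hne : (cyl O (n - 1) (proj O (n - 1) x)).Nonempty := ⟨x, rfl⟩
  refine csSup_sub_csInf_image_le hne fun a ha b hb => ?_
  rw [← Finset.sum_sub_distrib]
  refine le_of_eq_of_le ?_ (hn a ha b hb)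
  rw [← Fin.sum_univ_eq_sum_range]
  exact Finset.sum_congr rfl fun m _ => sub_sub_sub_cancel_right _ _ _

end
end
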